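/- arXiv:math/0401343 — 3 statements merged into one kernel-verified Lean document; each statement's English description precedes it below -/
import Mathlib

section
/- Let μ be a singular strong limit cardinal with 2^μ = μ⁺, and let θ = (2^(cf(μ)))⁺. Then there are compact Hausdorff totally disconnected topological spaces X and Y such that c(X) = μ, c(Y) < θ, and c(X × Y) = μ⁺. -/
universe u

open Cardinal

/-- `S` is a family of pairwise disjoint nonempty open subsets of `X`. -/
def IsCellularFamily {X : Type u} [TopologicalSpace X] (S : Set (Set X)) : Prop :=
  (∀ U ∈ S, IsOpen U ∧ U.Nonempty) ∧ S.PairwiseDisjoint id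

/-- The cellularity `c(X)`: the supremum of the cardinalities of families of pairwise
disjoint nonempty open subsets of `X`. -/
noncomputable def cellularity (X : Type u) [TopologicalSpace X] : Cardinal.{u} :=
  sSup {μ : Cardinal.{u} | ∃ S : Set (Set X), IsCellularFamily S ∧ #S = μ}

/-- `c'(X)`: the least cardinal `μ` such that `X` has no family of `μ` pairwise disjoint
nonempty open sets. -/
noncomputable def cellularity' (X : Type u) [TopologicalSpace X] : Cardinal.{u} :=
  sInf {μ : Cardinal.{u} | ¬ ∃ S : Set (Set X), IsCellularFamily S ∧ #S = μ}

section Tree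

variable {K : Type u} [LinearOrder K] (D S : K → Type u)

/-- Nodes of height `i` in the tree of partial branches: one pair from each `D j`, `j < i`. -/
abbrev LevelNode (i : K) : Type u := ∀ j : Set.Iio i, D j × D j

/-- A node together with its height. -/
abbrev TreeNode : Type u := Σ i : K, LevelNode D i

/-- A node together with one of its immediate successors. -/
abbrev TreeStep : Type u := Σ i : K, LevelNode D i × (D i × D i)

/-- Nodes of height below `i`. -/
abbrev TreeNodeBelow (i : K) : Type u := Σ j : Set.Iio i, LevelNode D j.1

/-- Steps of height below `i`. -/
abbrev TreeStepBelow (i : K) : Type u := Σ j : Set.Iio i, LevelNode D j.1 × (D j.1 × D j.1)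

variable {D}

/-- The node at which a step starts. -/
def TreeStep.source (τ : TreeStep D) : TreeNode D := ⟨τ.1, τ.2.1⟩

/-- Forget that a node has height below `i`. -/
def TreeNodeBelow.incl {i : K} (ν : TreeNodeBelow D i) : TreeNode D := ⟨ν.1.1, ν.2⟩

/-- Forget that a step has height below `i`. -/
def TreeStepBelow.incl {i : K} (τ : TreeStepBelow D i) : TreeStep D := ⟨τ.1.1, τ.2⟩

/-- The node of height `i` on a branch. -/
def branchNode (η : ∀ i, D i × D i) (i : K) : LevelNode D i := fun j => η j.1

/-- The step of height `i` on a branch. -/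
def branchStep (η : ∀ i, D i × D i) (i : K) : TreeStep D := ⟨i, branchNode η i, η i⟩

/-- The lists which, appended to `pre`, belong to `Φ`. -/
def sectionAt (Φ : Set (List (TreeStep D))) (pre : List (TreeStep D)) :
    Set (List (TreeStep D)) := {l | pre ++ l ∈ Φ}

/-- Two steps from a common node whose pairs form an edge `(a, b), (b, c)` of the shift graph. -/
def ShiftEdge (τ τ' : TreeStep D) : Prop :=
  ∃ (i : K) (t : LevelNode D i) (a b c : D i), τ = ⟨i, t, a, b⟩ ∧ τ' = ⟨i, t, b, c⟩

/-- A set of lists of steps is large over a list of nodes if it is positive for the iterated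
product of the ideals of those sets of pairs which some `f : D i → Set (S i)` separates. -/
def IsLarge : List (TreeNode D) → Set (List (TreeStep D)) → Prop
  | [], Φ => [] ∈ Φ
  | ⟨i, t⟩ :: rest, Φ => ∀ f : D i → Set (S i), ∃ x : D i × D i, f x.1 = f x.2 ∧
      IsLarge rest (sectionAt Φ [⟨i, t, x⟩])

/-- At height `i`, the branch `η` avoids every small set of successors determined by `Φ`. -/
def Evades (Φ : Set (List (TreeStep D))) (η : ∀ i, D i × D i) (i : K) : Prop :=
  ∀ rest : List (TreeNodeBelow D i),
    IsLarge S (rest.map TreeNodeBelow.incl) (sectionAt Φ [branchStep η i]) →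
      IsLarge S (⟨i, branchNode η i⟩ :: rest.map TreeNodeBelow.incl) Φ

variable {S}

theorem exists_map_nodeBelow {i : K} {l : List (TreeNode D)} (h : ∀ ν ∈ l, ν.1 < i) :
    ∃ l' : List (TreeNodeBelow D i), l'.map TreeNodeBelow.incl = l := by
  induction l with
  | nil => exact ⟨[], rfl⟩
  | cons ν l ih =>
    obtain ⟨l', hl'⟩ := ih fun ν' h' => h ν' (List.mem_cons_of_mem _ h')
    exact ⟨⟨⟨ν.1, h ν List.mem_cons_self⟩, ν.2⟩ :: l', by simp [hl', TreeNodeBelow.incl]⟩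

theorem exists_map_stepBelow {i : K} {l : List (TreeStep D)} (h : ∀ τ ∈ l, τ.1 < i) :
    ∃ l' : List (TreeStepBelow D i), l'.map TreeStepBelow.incl = l := by
  induction l with
  | nil => exact ⟨[], rfl⟩
  | cons τ l ih =>
    obtain ⟨l', hl'⟩ := ih fun τ' h' => h τ' (List.mem_cons_of_mem _ h')
    exact ⟨⟨⟨τ.1, h τ List.mem_cons_self⟩, τ.2⟩ :: l', by simp [hl', TreeStepBelow.incl]⟩

theorem IsLarge.exists_shiftEdge
    (hS : ∀ i, #(Set (List (TreeStepBelow D i))) ≤ #(S i)) {sk : List (TreeNode D)}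
    (hsk : sk.Pairwise fun ν ν' => ν'.1 < ν.1) {Φ : Set (List (TreeStep D))}
    (h : IsLarge S sk Φ) :
    ∃ xs ∈ Φ, ∃ ys ∈ Φ, xs.map TreeStep.source = sk ∧ List.Forall₂ ShiftEdge xs ys := by
  induction sk generalizing Φ with
  | nil => exact ⟨[], h, [], h, rfl, .nil⟩
  | cons ν rest ih =>
    obtain ⟨i, t⟩ := ν
    obtain ⟨e⟩ := hS i
    rw [List.pairwise_cons] at hsk
    let traceAt : D i × D i → Set (List (TreeStepBelow D i)) := fun x =>
      List.map TreeStepBelow.incl ⁻¹' sectionAt Φ [⟨i, t, x⟩]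
    obtain ⟨⟨a, b⟩, hab, hlarge⟩ := h fun a =>
      {s | ∃ b, IsLarge S rest (sectionAt Φ [⟨i, t, a, b⟩]) ∧ s = e (traceAt (a, b))}
    have hmem : e (traceAt (a, b)) ∈
        {s | ∃ b, IsLarge S rest (sectionAt Φ [⟨i, t, a, b⟩]) ∧ s = e (traceAt (a, b))} :=
      ⟨b, hlarge, rfl⟩
    obtain ⟨c, -, hc⟩ := hab ▸ hmem
    obtain ⟨xs, hxs, ys, hys, hmap, hedge⟩ := ih hsk.2 hlarge
    have hlow : ∀ τ ∈ ys, τ.1 < i := by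
      have : ys.map TreeStep.source = rest := by
        rw [← hmap]
        clear hmap hxs hys
        induction hedge with
        | nil => rfl
        | cons hd _ ih' =>
          obtain ⟨j, s, a', b', c', rfl, rfl⟩ := hd
          simp [ih', TreeStep.source]
      intro τ hτ
      exact hsk.1 τ.source (this ▸ List.mem_map_of_mem hτ)
    obtain ⟨ys', rfl⟩ := exists_map_stepBelow hlow
    have htr : traceAt (a, b) = traceAt (b, c) := e.injective hc
    have hys' : ys' ∈ traceAt (b, c) := htr ▸ hys
    exact ⟨_ :: xs, hxs, _ :: _, hys', by simp [hmap, TreeStep.source],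
      .cons ⟨i, t, a, b, c, rfl, rfl⟩ hedge⟩

/-- Every step of the list of branches `z`, taken at the indicated heights, evades the
corresponding section of `Φ`. -/
def EvadesAll (S : K → Type u) :
    List ((∀ i, D i × D i) × K) → Set (List (TreeStep D)) → Prop
  | [], _ => True
  | p :: z, Φ => Evades S Φ p.1 p.2 ∧ EvadesAll S z (sectionAt Φ [branchStep p.1 p.2])

theorem EvadesAll.isLarge {z : List ((∀ i, D i × D i) × K)} {Φ : Set (List (TreeStep D))}
    (hz : z.Pairwise fun p q => q.2 < p.2) (h : EvadesAll S z Φ)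
    (hmem : z.map (fun p => branchStep p.1 p.2) ∈ Φ) :
    IsLarge S (z.map fun p => (branchStep p.1 p.2).source) Φ := by
  induction z generalizing Φ with
  | nil => exact hmem
  | cons p z ih =>
    rw [List.pairwise_cons] at hz
    have hl := ih hz.2 h.2 hmem
    have hlow : ∀ ν ∈ z.map fun q => (branchStep q.1 q.2).source, ν.1 < p.2 := by
      intro ν hν
      obtain ⟨q, hq, rfl⟩ := List.mem_map.1 hν
      exact hz.1 q hq
    obtain ⟨rest, hrest⟩ := exists_map_nodeBelow hlow
    have hev := h.1 rest
    rw [hrest] at hev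
    exact hev hl

end Tree

section Branches

variable {K : Type u} [LinearOrder K] {D S : K → Type u} {Λ : Type u}
  {η : Λ → ∀ i, D i × D i}

/-- Two branches are adjacent if, at some height up to which they agree, their pairs form an
edge of the shift graph. -/
def BranchAdj (η : Λ → ∀ i, D i × D i) (α β : Λ) : Prop :=
  ∃ i, (∀ j < i, η α j = η β j) ∧ ((η α i).2 = (η β i).1 ∨ (η β i).2 = (η α i).1)

theorem BranchAdj.symm {α β : Λ} (h : BranchAdj η α β) : BranchAdj η β α := by
  obtain ⟨i, h, h'⟩ := h
  exact ⟨i, fun j hj => (h j hj).symm, h'.symm⟩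

theorem not_branchAdj_self (hη : ∀ α i, (η α i).1 ≠ (η α i).2) (α : Λ) : ¬ BranchAdj η α α := by
  rintro ⟨i, -, h | h⟩ <;> exact hη α i h.symm

theorem branchNode_eq_iff {f g : ∀ i, D i × D i} {i : K} :
    branchNode f i = branchNode g i ↔ ∀ j < i, f j = g j :=
  ⟨fun h j hj => congrFun h ⟨j, hj⟩, fun h => funext fun j => h j.1 j.2⟩

/-- The list of steps of the branches `η α` at height `i`, for `(α, i)` in a list. -/
def stepsAt (η : Λ → ∀ i, D i × D i) (z : List (Λ × K)) : List (TreeStep D) :=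
  z.map fun p => branchStep (η p.1) p.2

theorem ShiftEdge.of_branchStep {α β : Λ} {i j : K}
    (h : ShiftEdge (branchStep (η α) i) (branchStep (η β) j)) :
    i = j ∧ (∀ k < i, η α k = η β k) ∧ (η α i).2 = (η β i).1 := by
  obtain ⟨k, t, a, b, c, h₁, h₂⟩ := h
  obtain rfl : i = k := congrArg Sigma.fst h₁
  obtain rfl : j = i := congrArg Sigma.fst h₂
  simp only [branchStep, Sigma.mk.injEq, heq_eq_eq, true_and, Prod.mk.injEq] at h₁ h₂
  exact ⟨rfl, branchNode_eq_iff.1 (h₁.1.trans h₂.1.symm), by rw [h₁.2, h₂.2]⟩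

/-- No two distinct branches from `s` agree below any of the heights occurring in `z`. -/
def Splits (η : Λ → ∀ i, D i × D i) (s : Finset Λ) (z : List (Λ × K)) : Prop :=
  ∀ p ∈ z, ∀ α ∈ s, ∀ β ∈ s, α ≠ β → ¬ ∀ k < p.2, η α k = η β k

theorem branchAdj_of_forall₂_shiftEdge {s t : Finset Λ} {z z' : List (Λ × K)}
    (hs : ∀ α ∈ s, ∀ β ∈ s, α ≠ β → BranchAdj η α β) (hz : ∀ α, α ∈ z.map Prod.fst ↔ α ∈ s)
    (hz' : ∀ α, α ∈ z'.map Prod.fst ↔ α ∈ t) (hsep : Splits η s z)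
    (h : List.Forall₂ ShiftEdge (stepsAt η z) (stepsAt η z')) :
    ∀ α ∈ s, ∀ β ∈ t, BranchAdj η α β := by
  intro α hα β hβ
  obtain ⟨q, hq, rfl⟩ := List.mem_map.1 ((hz' β).2 hβ)
  rw [stepsAt, stepsAt, List.forall₂_map_left_iff, List.forall₂_map_right_iff] at h
  obtain ⟨p, hp, hpq⟩ : ∃ p ∈ z, ShiftEdge (branchStep (η p.1) p.2) (branchStep (η q.1) q.2) := by
    clear hz hz' hsep hβ
    induction h with
    | nil => simp at hq
    | cons hd _ ih =>
      rcases List.mem_cons.1 hq with rfl | hq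
      · exact ⟨_, List.mem_cons_self, hd⟩
      · obtain ⟨p, hp, h⟩ := ih hq
        exact ⟨p, List.mem_cons_of_mem _ hp, h⟩
  obtain ⟨-, hagree, hedge⟩ := hpq.of_branchStep
  by_cases hpα : α = p.1
  · subst hpα
    exact ⟨p.2, hagree, .inl hedge⟩
  · have hps : p.1 ∈ s := (hz _).1 (List.mem_map_of_mem hp)
    obtain ⟨d, hd, hd'⟩ := hs α hα p.1 hps hpα
    have hlt : d < p.2 := by
      by_contra hle
      exact hsep p hp α hα p.1 hps hpα fun k hk => hd k (hk.trans_le (not_lt.1 hle))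
    refine ⟨d, fun j hj => (hd j hj).trans (hagree j (hj.trans hlt)), ?_⟩
    rwa [← hagree d hlt]

theorem exists_splits [NoMaxOrder K] [Nonempty K] {s : Finset Λ}
    (hdiag : ∀ α i, (η α i).1 ≠ (η α i).2)
    (hs : ∀ α ∈ s, ∀ β ∈ s, α ≠ β → BranchAdj η α β) :
    ∃ i : K, ∀ z : List (Λ × K), (∀ p ∈ z, i ≤ p.2) → Splits η s z := by
  classical
  have hex : ∀ q : Λ × Λ, ∃ d : K, q.1 ∈ s → q.2 ∈ s → q.1 ≠ q.2 → η q.1 d ≠ η q.2 d := by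
    intro q
    by_cases hq : q.1 ∈ s ∧ q.2 ∈ s ∧ q.1 ≠ q.2
    · obtain ⟨d, -, hd⟩ := hs _ hq.1 _ hq.2.1 hq.2.2
      refine ⟨d, fun _ _ _ heq => ?_⟩
      rw [heq, or_self] at hd
      exact hdiag _ _ hd.symm
    · exact ⟨Classical.arbitrary K, fun h₁ h₂ h₃ => absurd ⟨h₁, h₂, h₃⟩ hq⟩
  choose d hd using hex
  obtain ⟨m, hm⟩ := ((s ×ˢ s).image d).exists_le
  obtain ⟨i, hi⟩ := exists_gt m
  refine ⟨i, fun z hz p hp α hα β hβ hne hagree => hd (α, β) hα hβ hne (hagree _ ?_)⟩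
  exact (hm _ (Finset.mem_image_of_mem d (Finset.mk_mem_product hα hβ))).trans_lt
    (hi.trans_le (hz p hp))

theorem exists_decreasing_heights [NoMaxOrder K] [Nonempty K] (l : List Λ) (i : K) :
    ∃ z : List (Λ × K), z.map Prod.fst = l ∧ (∀ p ∈ z, i ≤ p.2) ∧
      z.Pairwise fun p q => q.2 < p.2 := by
  classical
  induction l with
  | nil => exact ⟨[], rfl, by simp, .nil⟩
  | cons α l ih =>
    obtain ⟨z, rfl, hz, hz'⟩ := ih
    obtain ⟨m, hm⟩ := (insert i (z.map Prod.snd).toFinset).exists_le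
    obtain ⟨k, hk⟩ := exists_gt m
    refine ⟨(α, k) :: z, rfl, ?_, List.pairwise_cons.2 ⟨fun q hq => ?_, hz'⟩⟩
    · intro p hp
      rcases List.mem_cons.1 hp with rfl | hp
      · exact (hm i (Finset.mem_insert_self _ _)).trans hk.le
      · exact hz p hp
    · refine (hm q.2 (Finset.mem_insert_of_mem ?_)).trans_lt hk
      exact List.mem_toFinset.2 (List.mem_map_of_mem hq)

variable [LinearOrder Λ]

/-- The branches `η α` were chosen one after the other, each of them evading at almost all
heights the sections, determined by earlier branches, of the earlier sets `e ε`. -/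
def IsEvading (S : K → Type u) (η : Λ → ∀ i, D i × D i) (e : Λ → Set (List (TreeStep D))) :
    Prop :=
  ∀ α ε, ε < α → ∀ βs : List Λ, (∀ β ∈ βs, β < α) → ∃ i₀, ∀ i ≥ i₀, ∀ z : List (Λ × K),
    z.map Prod.fst = βs → Evades S (sectionAt (e ε) (stepsAt η z)) (η α) i

theorem IsEvading.evadesAll [Nonempty K] {e : Λ → Set (List (TreeStep D))} (h : IsEvading S η e)
    {ε : Λ} {l : List Λ} (hl : l.Pairwise (· < ·)) (hε : ∀ α ∈ l, ε < α) {βs : List Λ}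
    (hβs : ∀ β ∈ βs, ∀ α ∈ l, β < α) :
    ∃ i₁, ∀ z : List (Λ × K), z.map Prod.fst = l → (∀ p ∈ z, i₁ ≤ p.2) →
      ∀ w : List (Λ × K), w.map Prod.fst = βs →
        EvadesAll S (z.map fun p => (η p.1, p.2)) (sectionAt (e ε) (stepsAt η w)) := by
  induction l generalizing βs with
  | nil =>
    refine ⟨Classical.arbitrary K, fun z hz _ w _ => ?_⟩
    rw [List.map_eq_nil_iff.1 hz]
    trivial
  | cons α l ih =>
    rw [List.pairwise_cons] at hl
    obtain ⟨i₀, hi₀⟩ := h α ε (hε α List.mem_cons_self) βs fun β hβ => hβs β hβ α List.mem_cons_self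
    obtain ⟨i₁, hi₁⟩ := ih hl.2 (fun α' h' => hε α' (List.mem_cons_of_mem _ h'))
      (βs := βs ++ [α]) (by
        intro β hβ α' hα'
        rcases List.mem_append.1 hβ with hβ | hβ
        · exact hβs β hβ α' (List.mem_cons_of_mem _ hα')
        · rw [List.mem_singleton.1 hβ]
          exact hl.1 α' hα')
    refine ⟨max i₀ i₁, fun z hz hge w hw => ?_⟩
    obtain _ | ⟨⟨α', i⟩, z⟩ := z
    · simp at hz
    · obtain ⟨rfl, hz'⟩ := List.cons.inj hz
      refine ⟨hi₀ i ((le_max_left _ _).trans (hge _ List.mem_cons_self)) w hw, ?_⟩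
      have := hi₁ z hz' (fun p hp => (le_max_right _ _).trans (hge p (List.mem_cons_of_mem _ hp)))
        (w ++ [(α', i)]) (by simp [hw])
      simpa [sectionAt, stepsAt] using this

theorem IsEvading.exists_branchAdj [NoMaxOrder K] [Nonempty K] {e : Λ → Set (List (TreeStep D))}
    (h : IsEvading S η e) (he : Function.Surjective e)
    (hS : ∀ i, #(Set (List (TreeStepBelow D i))) ≤ #(S i))
    (hdiag : ∀ α i, (η α i).1 ≠ (η α i).2) {μ : Cardinal.{u}} (hΛ : ∀ ε : Λ, #(Set.Iic ε) ≤ μ)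
    {J : Type u} (hJ : μ < #J) {s : J → Finset Λ} (hne : ∀ j, (s j).Nonempty)
    (hdisj : Pairwise (Function.onFun Disjoint s))
    (hs : ∀ j, ∀ α ∈ s j, ∀ β ∈ s j, α ≠ β → BranchAdj η α β) :
    ∃ j j', j ≠ j' ∧ ∀ α ∈ s j, ∀ β ∈ s j', BranchAdj η α β := by
  obtain ⟨ε, hε⟩ := he {xs | ∃ j, ∃ z : List (Λ × K), z.map Prod.fst = (s j).sort (· ≤ ·) ∧
    Splits η (s j) z ∧ xs = stepsAt η z}
  obtain ⟨j, hj⟩ : ∃ j, ∀ α ∈ s j, ε < α := by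
    by_contra! hcon
    choose f hf hfε using hcon
    refine hJ.not_ge
      ((mk_le_of_injective (f := fun j => (⟨f j, hfε j⟩ : Set.Iic ε)) ?_).trans (hΛ ε))
    intro j j' hjj'
    by_contra hne'
    have heq : f j = f j' := congrArg Subtype.val hjj'
    exact Finset.disjoint_left.1 (hdisj hne') (hf j) (heq ▸ hf j')
  obtain ⟨i₀, hi₀⟩ := exists_splits hdiag (hs j)
  obtain ⟨i₁, hi₁⟩ := h.evadesAll (s j).sortedLT_sort.pairwise
    (fun α hα => hj α ((Finset.mem_sort _).1 hα)) (βs := []) (by simp)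
  obtain ⟨z, hz, hge, hpw⟩ := exists_decreasing_heights ((s j).sort (· ≤ ·)) (max i₀ i₁)
  have hev := hi₁ z hz (fun p hp => (le_max_right _ _).trans (hge p hp)) [] rfl
  have hsplit := hi₀ z fun p hp => (le_max_left _ _).trans (hge p hp)
  have hlarge := hev.isLarge (List.pairwise_map.2 hpw) (by
    rw [List.map_map, hε]
    exact ⟨j, z, hz, hsplit, rfl⟩)
  obtain ⟨xs, hxs, ys, hys, -, hedge⟩ := hlarge.exists_shiftEdge hS (by
    rw [List.map_map, List.pairwise_map]
    exact hpw)
  rw [hε] at hxs hys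
  obtain ⟨j₁, z₁, hz₁, hsp, rfl⟩ := hxs
  obtain ⟨j₂, z₂, hz₂, -, rfl⟩ := hys
  have hadj := branchAdj_of_forall₂_shiftEdge (hs j₁) (fun α => by rw [hz₁, Finset.mem_sort])
    (fun α => by rw [hz₂, Finset.mem_sort]) hsp hedge
  refine ⟨j₁, j₂, ?_, hadj⟩
  rintro rfl
  obtain ⟨α, hα⟩ := hne j₁
  exact not_branchAdj_self hdiag α (hadj α hα α hα)

end Branches

section Recursion

variable {K : Type u} [LinearOrder K] {D S : K → Type u}

/-- For few sets `Ψ t`, some pair of distinct elements of `D i` lies outside all the small sets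
of pairs which they determine over the nodes of height `i`. -/
theorem exists_evading_pair {i : K} (hinf : ℵ₀ ≤ #(S i)) (hnode : #(LevelNode D i) ≤ #(S i))
    (hbelow : #(TreeNodeBelow D i) ≤ #(S i)) (hD : 2 ^ #(S i) < #(D i)) {T : Type u}
    (hT : #T ≤ #(S i)) (Ψ : T → Set (List (TreeStep D))) :
    ∃ x : D i × D i, x.1 ≠ x.2 ∧ ∀ (t : T) (ν : LevelNode D i) (rest : List (TreeNodeBelow D i)),
      IsLarge S (rest.map TreeNodeBelow.incl) (sectionAt (Ψ t) [⟨i, ν, x⟩]) →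
        IsLarge S (⟨i, ν⟩ :: rest.map TreeNodeBelow.incl) (Ψ t) := by
  have hsep : ∀ q : T × LevelNode D i × List (TreeNodeBelow D i), ∃ f : D i → Set (S i),
      ∀ x : D i × D i, f x.1 = f x.2 →
        IsLarge S (q.2.2.map TreeNodeBelow.incl) (sectionAt (Ψ q.1) [⟨i, q.2.1, x⟩]) →
          IsLarge S (⟨i, q.2.1⟩ :: q.2.2.map TreeNodeBelow.incl) (Ψ q.1) := by
    intro q
    by_cases hq : IsLarge S (⟨i, q.2.1⟩ :: q.2.2.map TreeNodeBelow.incl) (Ψ q.1)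
    · exact ⟨fun _ => ∅, fun _ _ _ => hq⟩
    · have hq' := hq
      simp only [IsLarge, not_forall, not_exists, not_and] at hq'
      obtain ⟨f, hf⟩ := hq'
      exact ⟨f, fun x hx hl => absurd hl (hf x hx)⟩
  choose f hf using hsep
  let F : D i → T × LevelNode D i × List (TreeNodeBelow D i) → Set (S i) := fun a q => f q a
  have hcard : #(T × LevelNode D i × List (TreeNodeBelow D i)) ≤ #(S i) := by
    simp only [mk_prod, lift_id]
    refine (mul_le_mul' hT (mul_le_mul' hnode ((mk_list_le_max _).trans
      (max_le hinf hbelow)))).trans ?_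
    rw [mul_eq_self hinf, mul_eq_self hinf]
  have hF : ¬ Function.Injective F := by
    intro hinj
    refine (mk_le_of_injective hinj).not_gt (lt_of_le_of_lt ?_ hD)
    rw [← power_def, mk_set, ← power_mul]
    exact power_le_power_left two_ne_zero
      ((mul_le_mul' le_rfl hcard).trans (mul_eq_self hinf).le)
  simp only [Function.Injective, not_forall] at hF
  obtain ⟨a, b, hab, hne⟩ := hF
  exact ⟨(a, b), hne, fun t ν rest => hf (t, ν, rest) (a, b) (congrFun hab (t, ν, rest))⟩

theorem exists_evading_branch (hinf : ∀ i, ℵ₀ ≤ #(S i)) (hK : ∀ i, #K ≤ #(S i))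
    (hnode : ∀ i, #(LevelNode D i) ≤ #(S i)) (hbelow : ∀ i, #(TreeNodeBelow D i) ≤ #(S i))
    (hD : ∀ i, 2 ^ #(S i) < #(D i)) {W : Type u} (r : W → K)
    (hr : ∀ i, #{w // r w ≤ i} ≤ #(S i)) (Ψ : W → List K → Set (List (TreeStep D))) :
    ∃ η : ∀ i, D i × D i, (∀ i, (η i).1 ≠ (η i).2) ∧
      ∀ w, ∀ i ≥ r w, ∀ js, Evades S (Ψ w js) η i := by
  have hT : ∀ i, #({w // r w ≤ i} × List K) ≤ #(S i) := by
    intro i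
    rw [mk_prod, lift_id, lift_id]
    exact (mul_le_mul' (hr i) ((mk_list_le_max _).trans (max_le (hinf i) (hK i)))).trans
      (mul_eq_self (hinf i)).le
  choose η hη using fun i => exists_evading_pair (hinf i) (hnode i) (hbelow i) (hD i) (hT i)
    fun t => Ψ t.1 t.2
  exact ⟨η, fun i => (hη i).1, fun w i hi js rest => (hη i).2 (⟨w, hi⟩, js) _ rest⟩

theorem exists_isEvading (hinf : ∀ i, ℵ₀ ≤ #(S i)) (hK : ∀ i, #K ≤ #(S i))
    (hnode : ∀ i, #(LevelNode D i) ≤ #(S i)) (hbelow : ∀ i, #(TreeNodeBelow D i) ≤ #(S i))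
    (hD : ∀ i, 2 ^ #(S i) < #(D i)) {Λ : Type u} [LinearOrder Λ] [WellFoundedLT Λ]
    {μ : Cardinal.{u}} (hμ : ℵ₀ ≤ μ) (hΛ : ∀ α : Λ, #(Set.Iio α) ≤ μ)
    (hr : ∀ W : Type u, #W ≤ μ → ∃ r : W → K, ∀ i, #{w // r w ≤ i} ≤ #(S i))
    (e : Λ → Set (List (TreeStep D))) :
    ∃ η : Λ → ∀ i, D i × D i, (∀ α i, (η α i).1 ≠ (η α i).2) ∧ IsEvading S η e := by
  have hW : ∀ α : Λ, #(Set.Iio α × List (Set.Iio α)) ≤ μ := by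
    intro α
    rw [mk_prod, lift_id, lift_id]
    exact (mul_le_mul' (hΛ α) ((mk_list_le_max _).trans (max_le hμ (hΛ α)))).trans
      (mul_eq_self hμ).le
  choose r hr using fun α => hr _ (hW α)
  have hstep : ∀ (α : Λ) (η : ∀ β, β < α → ∀ i, D i × D i), ∃ ζ : ∀ i, D i × D i,
      (∀ i, (ζ i).1 ≠ (ζ i).2) ∧ ∀ w, ∀ i ≥ r α w, ∀ js, Evades S (sectionAt (e w.1)
        ((w.2.zip js).map fun p => branchStep (η p.1.1 p.1.2) p.2)) ζ i :=
    fun α η => exists_evading_branch hinf hK hnode hbelow hD (r α) (hr α) _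
  choose step hdiag hstep using hstep
  let η : Λ → ∀ i, D i × D i := wellFounded_lt.fix step
  have hη : ∀ α, η α = step α fun β _ => η β := fun α => wellFounded_lt.fix_eq step α
  refine ⟨η, fun α => hη α ▸ hdiag α _, fun α ε hε βs hβs => ?_⟩
  refine ⟨r α (⟨ε, hε⟩, βs.attachWith _ hβs), fun i hi z hz => ?_⟩
  have := hstep α (fun β _ => η β) (⟨ε, hε⟩, βs.attachWith _ hβs) i hi (z.map Prod.snd)
  rw [← hη α] at this
  convert this using 2
  subst hz
  clear this hi
  induction z with
  | nil => rfl
  | cons p z ih => simpa [stepsAt] using ih fun β hβ => hβs β (List.mem_cons_of_mem _ hβ)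

end Recursion

section Levels

theorem mk_Iio_ord_toType_lt {c : Cardinal.{u}} (i : c.ord.ToType) : #(Set.Iio i) < c := by
  simpa using mk_Iio_lt i (by simp)

theorem exists_strongLimit_levels {μ : Cardinal.{u}} (hμ : ℵ₀ ≤ μ) (hsing : μ.ord.cof < μ)
    (hsl : ∀ ν : Cardinal.{u}, ν < μ → 2 ^ ν < μ) :
    ∃ b : μ.ord.cof.ord.ToType → Cardinal.{u}, (∀ i, b i < μ) ∧ (∀ i, μ.ord.cof ≤ b i) ∧
      (∀ i, ∀ j < i, 2 ^ (2 ^ (2 ^ b j : Cardinal.{u}) : Cardinal.{u}) ≤ b i) ∧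
      μ ≤ Cardinal.sum b := by
  obtain ⟨s, hs, hcard⟩ := Order.exists_cof_eq μ.ord.ToType
  rw [Ordinal.cof_toType] at hcard
  obtain ⟨f⟩ : Nonempty (μ.ord.cof.ord.ToType ≃ s) := by
    rw [← Cardinal.eq, mk_ord_toType, hcard]
  let step (i : μ.ord.cof.ord.ToType) (b : ∀ j, j < i → Cardinal.{u}) : Cardinal.{u} :=
    max (max μ.ord.cof #(Set.Iic (f i).1))
      (⨆ j : Set.Iio i, 2 ^ (2 ^ (2 ^ b j.1 j.2 : Cardinal.{u}) : Cardinal.{u}))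
  let b : μ.ord.cof.ord.ToType → Cardinal.{u} := wellFounded_lt.fix step
  have hb : ∀ i, b i = step i fun j _ => b j := fun i => wellFounded_lt.fix_eq step i
  refine ⟨b, fun i => ?_, fun i => ?_, fun i j hj => ?_, ?_⟩
  · induction i using WellFoundedLT.induction with
    | ind i ih =>
      rw [hb i]
      refine max_lt (max_lt hsing ?_) ?_
      · rw [← Set.Iio_insert]
        refine (mk_insert_le).trans_lt ?_
        exact add_lt_of_lt hμ (mk_Iio_ord_toType_lt _) (one_lt_aleph0.trans_le hμ)
      · refine iSup_lt_of_lt_cof_ord (mk_Iio_ord_toType_lt i) fun j => ?_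
        exact hsl _ (hsl _ (hsl _ (ih j.1 j.2)))
  · rw [hb i]
    exact (le_max_left _ _).trans (le_max_left _ _)
  · rw [hb i]
    refine le_max_of_le_right ?_
    exact le_ciSup (f := fun j : Set.Iio i =>
      (2 ^ (2 ^ (2 ^ b j.1 : Cardinal.{u}) : Cardinal.{u}) : Cardinal.{u}))
      bddAbove_of_small ⟨j, hj⟩
  · have hcover : (Set.univ : Set μ.ord.ToType) = ⋃ i, Set.Iic (f i).1 := by
      refine (Set.eq_univ_of_forall fun x => ?_).symm
      obtain ⟨y, hy, hxy⟩ := hs x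
      exact Set.mem_iUnion.2 ⟨f.symm ⟨y, hy⟩, by simpa using hxy⟩
    calc μ = #(Set.univ : Set μ.ord.ToType) := by rw [mk_univ, mk_ord_toType]
      _ ≤ Cardinal.sum fun i => #(Set.Iic (f i).1) := by
        rw [hcover]
        exact mk_iUnion_le_sum_mk
      _ ≤ Cardinal.sum b := by
        refine sum_le_sum _ _ fun i => ?_
        rw [hb i]
        exact (le_max_right _ _).trans (le_max_left _ _)

/-- A set of size at most `μ` is an increasing union of sets of the sizes of the levels. -/
theorem exists_rank_of_le_sum {K : Type u} [LinearOrder K] {b : K → Cardinal.{u}}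
    (hb : Monotone b) (hK : ∀ i, #K ≤ b i) (hinf : ∀ i, ℵ₀ ≤ b i) {W : Type u}
    (hW : #W ≤ Cardinal.sum b) :
    ∃ r : W → K, ∀ i, #{w // r w ≤ i} ≤ b i := by
  have hsum : Cardinal.sum b = #(Σ i, (b i).out) := by simp
  rw [hsum] at hW
  obtain ⟨g⟩ := hW
  refine ⟨fun w => (g w).1, fun i => ?_⟩
  let g' : {w // (g w).1 ≤ i} → Σ j : Set.Iic i, (b j.1).out := fun w =>
    ⟨⟨(g w.1).1, w.2⟩, (g w.1).2⟩
  have hg' : Function.Injective g' := by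
    intro w w' h
    refine Subtype.ext (g.injective ?_)
    exact congrArg (fun q : Σ j : Set.Iic i, (b j.1).out => (⟨q.1.1, q.2⟩ : Σ j, (b j).out)) h
  refine (mk_le_of_injective hg').trans ?_
  rw [mk_sigma]
  calc (Cardinal.sum fun j : Set.Iic i => #(b j.1).out)
      ≤ Cardinal.sum fun _ : Set.Iic i => b i := sum_le_sum _ _ fun j => by
        rw [mk_out]
        exact hb j.2
    _ = #(Set.Iic i) * b i := by rw [sum_const']
    _ ≤ b i * b i := mul_le_mul' ((mk_set_le _).trans (hK i)) le_rfl
    _ = b i := mul_eq_self (hinf i)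

theorem mk_levelNode_le {K : Type u} [LinearOrder K] {D : K → Type u} {b : K → Cardinal.{u}}
    (hK : ∀ i, #K ≤ b i) (hinf : ∀ i, ℵ₀ ≤ b i)
    (hD : ∀ i, ∀ j < i, #(D j) ≤ b i) (i : K) : #(LevelNode D i) ≤ 2 ^ b i := by
  rw [mk_pi]
  calc (Cardinal.prod fun j : Set.Iio i => #(D j × D j))
      ≤ Cardinal.prod fun _ : Set.Iio i => b i := prod_le_prod _ _ fun j => by
        rw [mk_prod, lift_id]
        exact (mul_le_mul' (hD i j j.2) (hD i j j.2)).trans (mul_eq_self (hinf i)).le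
    _ = b i ^ #(Set.Iio i) := prod_const' _ _
    _ ≤ b i ^ b i := power_le_power_left (aleph0_pos.trans_le (hinf i)).ne'
        ((mk_set_le _).trans (hK i))
    _ = 2 ^ b i := power_self_eq (hinf i)

theorem mk_sigma_Iio_le {K : Type u} [LinearOrder K] {b : K → Cardinal.{u}}
    (hK : ∀ i, #K ≤ b i) (hinf : ∀ i, ℵ₀ ≤ b i) {i : K} {c : Cardinal.{u}}
    (hc : b i ≤ c) {E : Set.Iio i → Type u} (hE : ∀ j, #(E j) ≤ c) : #(Σ j, E j) ≤ c := by
  rw [mk_sigma]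
  calc (Cardinal.sum fun j => #(E j)) ≤ Cardinal.sum fun _ : Set.Iio i => c := sum_le_sum _ _ hE
    _ = #(Set.Iio i) * c := sum_const' _ _
    _ ≤ c * c := mul_le_mul' (((mk_set_le _).trans (hK i)).trans hc) le_rfl
    _ = c := mul_eq_self ((hinf i).trans hc)

/-- The combinatorial core: `μ⁺` branches through a tree of height `cf μ`, with the property that
among more than `μ` pairwise disjoint finite cliques two have a union which is again complete. -/
theorem exists_branches {μ : Cardinal.{u}} (hμ : ℵ₀ ≤ μ) (hsing : μ.ord.cof < μ)
    (hsl : ∀ ν : Cardinal.{u}, ν < μ → 2 ^ ν < μ) (hch : 2 ^ μ = Order.succ μ) :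
    ∃ (K : Type u) (_ : LinearOrder K) (D : K → Type u) (Λ : Type u)
      (η : Λ → ∀ i, D i × D i), #K = μ.ord.cof ∧ #Λ = Order.succ μ ∧
      (∀ α i, (η α i).1 ≠ (η α i).2) ∧
      ∀ (J : Type u) (s : J → Finset Λ), μ < #J → (∀ j, (s j).Nonempty) →
        Pairwise (Function.onFun Disjoint s) →
        (∀ j, ∀ α ∈ s j, ∀ β ∈ s j, α ≠ β → BranchAdj η α β) →
        ∃ j j', j ≠ j' ∧ ∀ α ∈ s j, ∀ β ∈ s j', BranchAdj η α β := by
  obtain ⟨b, hbμ, hκb, hbb, hsum⟩ := exists_strongLimit_levels hμ hsing hsl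
  let K := μ.ord.cof.ord.ToType
  have hcof : ℵ₀ ≤ μ.ord.cof := Ordinal.aleph0_le_cof_iff.2
    (Ordinal.one_lt_cof_iff.2 (isSuccLimit_ord hμ))
  have hmkK : #K = μ.ord.cof := mk_ord_toType _
  have : NoMaxOrder K := noMaxOrder hcof
  have : Nonempty K := by
    rw [← mk_ne_zero_iff, hmkK]
    exact (aleph0_pos.trans_le hcof).ne'
  have hK : ∀ i, #K ≤ b i := fun i => hmkK ▸ hκb i
  have hinf : ∀ i, ℵ₀ ≤ b i := fun i => hcof.trans (hκb i)
  let S : K → Type u := fun i => (2 ^ b i : Cardinal.{u}).out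
  let D : K → Type u := fun i => (2 ^ (2 ^ (2 ^ b i : Cardinal.{u}) : Cardinal.{u}) :
    Cardinal.{u}).out
  have hSc : ∀ i, #(S i) = 2 ^ b i := fun i => mk_out _
  have hDc : ∀ i, #(D i) = 2 ^ (2 ^ (2 ^ b i : Cardinal.{u}) : Cardinal.{u}) := fun i => mk_out _
  have hDb : ∀ i, ∀ j < i, #(D j) ≤ b i := fun i j hj => (hDc j).trans_le (hbb i j hj)
  have hmono : Monotone b := by
    intro j i hji
    rcases hji.eq_or_lt with rfl | hlt
    · exact le_rfl
    · exact (((cantor _).trans (cantor _)).trans (cantor _)).le.trans (hbb i j hlt)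
  have hlevel : ∀ i, ∀ j < i, #(LevelNode D j) ≤ b i := fun i j hj =>
    (mk_levelNode_le hK hinf hDb j).trans
      (((cantor _).trans (cantor _)).le.trans (hbb i j hj))
  have hDD : ∀ i, ∀ j < i, #(D j × D j) ≤ b i := fun i j hj => by
    rw [mk_prod, lift_id]
    exact (mul_le_mul' (hDb i j hj) (hDb i j hj)).trans (mul_eq_self (hinf i)).le
  have hstep : ∀ i, #(TreeStepBelow D i) ≤ b i := fun i =>
    mk_sigma_Iio_le hK hinf le_rfl fun j => by
    rw [mk_prod, lift_id, lift_id]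
    exact (mul_le_mul' (hlevel i j j.2) (hDD i j j.2)).trans (mul_eq_self (hinf i)).le
  have hS : ∀ i, #(Set (List (TreeStepBelow D i))) ≤ #(S i) := fun i => by
    rw [mk_set, hSc]
    exact power_le_power_left two_ne_zero
      ((mk_list_le_max _).trans (max_le (hinf i) (hstep i)))
  have hmkStep : #(TreeStep D) ≤ μ := by
    rw [mk_sigma]
    calc (Cardinal.sum fun i => #(LevelNode D i × (D i × D i)))
        ≤ Cardinal.sum fun _ : K => μ := sum_le_sum _ _ fun i => by
          obtain ⟨k, hk⟩ := exists_gt i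
          rw [mk_prod, lift_id, lift_id]
          exact ((mul_le_mul' (hlevel k i hk) (hDD k i hk)).trans (mul_eq_self (hinf k)).le).trans
            (hbμ k).le
      _ = #K * μ := sum_const' _ _
      _ ≤ μ * μ := mul_le_mul' (hmkK.trans_le hsing.le) le_rfl
      _ = μ := mul_eq_self hμ
  let Λ := (Order.succ μ).ord.ToType
  have hΛ : #Λ = Order.succ μ := mk_ord_toType _
  have hsets : #(Set (List (TreeStep D))) ≤ #Λ := by
    rw [mk_set, hΛ, ← hch]
    exact power_le_power_left two_ne_zero ((mk_list_le_max _).trans (max_le hμ hmkStep))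
  obtain ⟨e, he⟩ : ∃ e : Λ → Set (List (TreeStep D)), Function.Surjective e := by
    obtain ⟨g⟩ := hsets
    exact ⟨Function.invFun g, Function.invFun_surjective g.injective⟩
  have hIio : ∀ α : Λ, #(Set.Iio α) ≤ μ := fun α => Order.lt_succ_iff.1 (mk_Iio_ord_toType_lt α)
  have hIic : ∀ α : Λ, #(Set.Iic α) ≤ μ := fun α => by
    rw [← Set.Iio_insert]
    exact mk_insert_le.trans (add_le_of_le hμ (hIio α) (one_lt_aleph0.le.trans hμ))
  have hbS : ∀ i, b i ≤ #(S i) := fun i => (hSc i).symm ▸ (cantor _).le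
  obtain ⟨η, hdiag, hη⟩ := exists_isEvading (S := S) (fun i => (hinf i).trans (hbS i))
    (fun i => (hK i).trans (hbS i)) (fun i => (hSc i).symm ▸ mk_levelNode_le hK hinf hDb i)
    (fun i => (mk_sigma_Iio_le hK hinf le_rfl fun j => hlevel i j j.2).trans (hbS i))
    (fun i => by rw [hSc, hDc]; exact cantor _) hμ hIio
    (fun W hW => by
      obtain ⟨r, hr⟩ := exists_rank_of_le_sum hmono hK hinf (hW.trans hsum)
      exact ⟨r, fun i => (hr i).trans (hbS i)⟩) e
  exact ⟨K, inferInstance, D, Λ, η, hmkK, hΛ, hdiag, fun J s hJ hne hdisj hs =>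
    hη.exists_branchAdj he hS hdiag hIic hJ hne hdisj hs⟩

end Levels

section FiniteFamilies

/-- The partial functions with values `true` on `s`, `false` on `t` and `true` on `s'`, `false` on
`t'` have a common extension to the characteristic function of a finite clique of `R`. -/
def Compatible {V : Type u} (R : V → V → Prop) (s t s' t' : Finset V) : Prop :=
  ((s : Set V) ∪ s').Pairwise R ∧ Disjoint s t' ∧ Disjoint s' t

variable {J V : Type u} {μ : Cardinal.{u}}

theorem mk_meets_le (hμ : ℵ₀ ≤ μ) {u : J → Finset V} (hu : ∀ v, #{j | v ∈ u j} ≤ μ) {M : Set V}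
    (hM : #M ≤ μ) : #{j | ∃ v ∈ M, v ∈ u j} ≤ μ := by
  have : {j | ∃ v ∈ M, v ∈ u j} = ⋃ v : M, {j | v.1 ∈ u j} := by ext; simp
  rw [this]
  exact (mk_iUnion_le_sum_mk).trans <| (sum_le_sum _ _ fun v : M => hu v).trans <| by
    rw [sum_const']
    exact (mul_le_mul' hM le_rfl).trans (mul_eq_self hμ).le

theorem exists_pairwiseDisjoint_of_mk_fiber_le (hμ : ℵ₀ ≤ μ) {u : J → Finset V}
    (hu : ∀ v, #{j | v ∈ u j} ≤ μ) (hJ : μ < #J) :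
    ∃ T : Set J, μ < #T ∧ T.PairwiseDisjoint u := by
  obtain ⟨T, hT⟩ := zorn_subset {T : Set J | T.PairwiseDisjoint u} fun c hc hchain =>
    ⟨⋃₀ c, (Set.pairwiseDisjoint_sUnion hchain.directedOn).2 fun T hT => hc hT,
      fun T hT => Set.subset_sUnion_of_mem hT⟩
  refine ⟨T, ?_, hT.prop⟩
  by_contra hle
  rw [not_lt] at hle
  have hcover : (Set.univ : Set J) ⊆ T ∪ {j | ∃ v ∈ ⋃ k : T, (u k.1 : Set V), v ∈ u j} := by
    intro j _
    by_contra hj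
    simp only [Set.mem_union, Set.mem_ofPred_eq, not_or, not_exists, not_and] at hj
    refine hj.1 (hT.le_of_ge (y := insert j T) ?_ (Set.subset_insert j T) (Set.mem_insert j T))
    refine Set.PairwiseDisjoint.insert hT.prop fun k hk _ => ?_
    refine Finset.disjoint_left.2 fun v hvj hvk => hj.2 v ?_ hvj
    exact Set.mem_iUnion.2 ⟨⟨k, hk⟩, hvk⟩
  have hM : #(⋃ k : T, (u k.1 : Set V)) ≤ μ :=
    (mk_iUnion_le_sum_mk).trans <| (sum_le_sum _ (fun _ => μ) fun k : T =>
      ((u k.1).finite_toSet.lt_aleph0.le.trans hμ)).trans <| by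
      rw [sum_const']
      exact (mul_le_mul' hle le_rfl).trans (mul_eq_self hμ).le
  refine hJ.not_ge ?_
  rw [← mk_univ]
  exact (mk_le_mk_of_subset hcover).trans <| (mk_union_le _ _).trans <|
    add_le_of_le hμ hle (mk_meets_le hμ hu hM)

variable {A : V → V → Prop} {M : Set V}

/-- If among many disjoint finite cliques of `A` two are completely joined, then among many
finite partial characteristic functions of cliques of `A` off `M` two are compatible. -/
theorem exists_compatible_of_card_eq (hμ : ℵ₀ ≤ μ) (hsymm : ∀ a b, A a b → A b a)
    (hM : #M ≤ μ)
    (hA : ∀ (J : Type u) (s : J → Finset V), μ < #J → (∀ j, (s j).Nonempty) →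
      Pairwise (Function.onFun Disjoint s) → (∀ j, ∀ a ∈ s j, ∀ b ∈ s j, a ≠ b → A a b) →
      ∃ j j', j ≠ j' ∧ ∀ a ∈ s j, ∀ b ∈ s j', A a b) (n : ℕ) :
    ∀ (J : Type u) (s t : J → Finset V), μ < #J →
      (∀ j, (s j : Set V).Pairwise fun a b => A a b ∧ a ∉ M ∧ b ∉ M) →
      (∀ j, Disjoint (s j) (t j)) → (∀ j, (s j).card + (t j).card = n) →
      ∃ j j', j ≠ j' ∧ Compatible (fun a b => A a b ∧ a ∉ M ∧ b ∉ M) (s j) (t j) (s j') (t j') := by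
  classical
  induction n with
  | zero =>
    intro J s t hJ _ _ hn
    have : Nontrivial J := one_lt_iff_nontrivial.1 ((one_lt_aleph0.trans_le hμ).trans hJ)
    obtain ⟨j, j', hne⟩ := exists_pair_ne J
    have hs : ∀ j, s j = ∅ := fun j => Finset.card_eq_zero.1 (Nat.eq_zero_of_add_eq_zero (hn j)).1
    exact ⟨j, j', hne, by simp [Compatible, hs]⟩
  | succ n ih =>
    intro J s t hJ hs hst hn
    by_cases h₁ : ∃ v, μ < #{j | v ∈ s j}
    · obtain ⟨v, hv⟩ := h₁
      obtain ⟨⟨j, hj⟩, ⟨j', hj'⟩, hne, hcl, hd, hd'⟩ := ih {j | v ∈ s j}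
        (fun j => (s j).erase v) (fun j => t j) hv
        (fun j => (hs j).mono (by simp))
        (fun j => (hst j).mono_left (Finset.erase_subset _ _))
        (fun j => by
          have := hn j
          have := Finset.card_erase_add_one j.2
          omega)
      refine ⟨j, j', fun h => hne (Subtype.ext h), ?_, ?_, ?_⟩
      · intro a ha b hb hab
        by_cases hav : a = v
        · subst hav
          rcases hb with hb | hb
          · exact hs j hj hb hab
          · exact hs j' hj' hb hab
        by_cases hbv : b = v
        · subst hbv
          rcases ha with ha | ha
          · exact hs j ha hj hab
          · exact hs j' ha hj' hab
        refine hcl ?_ ?_ hab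
        · simpa [hav] using ha
        · simpa [hbv] using hb
      · rw [← Finset.insert_erase hj, Finset.disjoint_insert_left]
        exact ⟨Finset.disjoint_left.1 (hst j') hj', hd⟩
      · rw [← Finset.insert_erase hj', Finset.disjoint_insert_left]
        exact ⟨Finset.disjoint_left.1 (hst j) hj, hd'⟩
    by_cases h₂ : ∃ v, μ < #{j | v ∈ t j}
    · obtain ⟨v, hv⟩ := h₂
      obtain ⟨⟨j, hj⟩, ⟨j', hj'⟩, hne, hcl, hd, hd'⟩ := ih {j | v ∈ t j}
        (fun j => s j) (fun j => (t j).erase v) hv (fun j => hs j)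
        (fun j => (hst j).mono_right (Finset.erase_subset _ _))
        (fun j => by
          have := hn j
          have := Finset.card_erase_add_one j.2
          omega)
      refine ⟨j, j', fun h => hne (Subtype.ext h), hcl, ?_, ?_⟩
      · rw [← Finset.insert_erase hj', Finset.disjoint_insert_right]
        exact ⟨Finset.disjoint_right.1 (hst j) hj, hd⟩
      · rw [← Finset.insert_erase hj, Finset.disjoint_insert_right]
        exact ⟨Finset.disjoint_right.1 (hst j') hj', hd'⟩
    push Not at h₁ h₂
    obtain ⟨T, hT, hdisj⟩ := exists_pairwiseDisjoint_of_mk_fiber_le (u := fun j => s j ∪ t j) hμ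
      (fun v => by
        have : {j | v ∈ s j ∪ t j} = {j | v ∈ s j} ∪ {j | v ∈ t j} := by ext; simp
        rw [this]
        exact (mk_union_le _ _).trans (add_le_of_le hμ (h₁ v) (h₂ v))) hJ
    have hdisj' : ∀ j ∈ T, ∀ j' ∈ T, j ≠ j' →
        Disjoint (s j) (s j') ∧ Disjoint (s j) (t j') ∧ Disjoint (s j') (t j) := by
      intro j hj j' hj' hne
      have := hdisj hj hj' hne
      simp only [Function.onFun, Finset.disjoint_union_left, Finset.disjoint_union_right] at this
      exact ⟨this.1.1, this.2.1, this.1.2.symm⟩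
    by_cases hemp : ∃ j ∈ T, s j = ∅
    · obtain ⟨j, hj, hempty⟩ := hemp
      have hnt : Nontrivial T := one_lt_iff_nontrivial.1 ((one_lt_aleph0.trans_le hμ).trans hT)
      obtain ⟨⟨j', hj'⟩, hne⟩ := exists_ne (⟨j, hj⟩ : T)
      have hne' : j ≠ j' := fun h => hne (Subtype.ext h.symm)
      refine ⟨j, j', hne', ?_, (hdisj' j hj j' hj' hne').2⟩
      simpa [hempty] using hs j'
    have hT' : μ < #{j : T | ∀ v ∈ M, v ∉ s j} := by
      by_contra hle
      refine hT.not_ge ?_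
      rw [← mk_univ]
      refine (mk_le_mk_of_subset (t := {j : T | ∀ v ∈ M, v ∉ s j} ∪
        {j : T | ∃ v ∈ M, v ∈ s j}) fun j _ => ?_).trans <| (mk_union_le _ _).trans <|
        add_le_of_le hμ (not_lt.1 hle) (mk_meets_le hμ (fun v => ?_) hM)
      · by_cases h : ∃ v ∈ M, v ∈ s j
        · exact .inr h
        · left
          push Not at h
          exact h
      · exact (mk_preimage_of_injective _ {j | v ∈ s j} Subtype.val_injective).trans (h₁ v)
    obtain ⟨j, j', hne, hjoin⟩ := hA _ (fun j : {j : T | ∀ v ∈ M, v ∉ s j} => s j) hT'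
      (fun j => Finset.nonempty_iff_ne_empty.2 fun h => hemp ⟨_, j.1.2, h⟩)
      (fun j j' hne => (hdisj' _ j.1.2 _ j'.1.2 fun h => hne
        (Subtype.ext (Subtype.ext h))).1)
      (fun j a ha b hb hab => (hs j ha hb hab).1)
    have hne' : j.1.1 ≠ j'.1.1 := fun h => hne (Subtype.ext (Subtype.ext h))
    refine ⟨j.1.1, j'.1.1, hne', ?_, (hdisj' _ j.1.2 _ j'.1.2 hne').2⟩
    rintro a (ha | ha) b (hb | hb) hab
    · exact hs _ ha hb hab
    · exact ⟨hjoin a ha b hb, fun h => j.2 a h ha, fun h => j'.2 b h hb⟩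
    · exact ⟨hsymm _ _ (hjoin b hb a ha), fun h => j'.2 a h ha, fun h => j.2 b h hb⟩
    · exact hs _ ha hb hab

theorem exists_compatible (hμ : ℵ₀ ≤ μ) (hsymm : ∀ a b, A a b → A b a) (hM : #M ≤ μ)
    (hA : ∀ (J : Type u) (s : J → Finset V), μ < #J → (∀ j, (s j).Nonempty) →
      Pairwise (Function.onFun Disjoint s) → (∀ j, ∀ a ∈ s j, ∀ b ∈ s j, a ≠ b → A a b) →
      ∃ j j', j ≠ j' ∧ ∀ a ∈ s j, ∀ b ∈ s j', A a b)
    {s t : J → Finset V} (hJ : μ < #J)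
    (hs : ∀ j, (s j : Set V).Pairwise fun a b => A a b ∧ a ∉ M ∧ b ∉ M)
    (hst : ∀ j, Disjoint (s j) (t j)) :
    ∃ j j', j ≠ j' ∧ Compatible (fun a b => A a b ∧ a ∉ M ∧ b ∉ M) (s j) (t j) (s j') (t j') := by
  obtain ⟨n, hn⟩ : ∃ n : ℕ, μ < #{j | (s j).card + (t j).card = n} := by
    by_contra! hle
    refine hJ.not_ge ?_
    have hcover : (Set.univ : Set J) =
        ⋃ n : ULift.{u} ℕ, {j | (s j).card + (t j).card = n.down} := by
      refine (Set.eq_univ_of_forall fun j => ?_).symm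
      exact Set.mem_iUnion.2 ⟨⟨_⟩, rfl⟩
    rw [← mk_univ, hcover]
    refine (mk_iUnion_le_sum_mk).trans <|
      (sum_le_sum _ _ fun n : ULift.{u} ℕ => hle n.down).trans ?_
    rw [sum_const']
    exact (mul_le_mul' (by simpa using hμ) le_rfl).trans (mul_eq_self hμ).le
  obtain ⟨j, j', hne, h⟩ := exists_compatible_of_card_eq hμ hsymm hM hA n
    {j | (s j).card + (t j).card = n} (fun j => s j) (fun j => t j) hn (fun j => hs j)
    (fun j => hst j) fun j => j.2
  exact ⟨j, j', fun h => hne (Subtype.ext h), h⟩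

end FiniteFamilies

section Separation

/-- Membership of `w` in the set coded by `q = (c, p, Q)`: the trace of `ι w` on `c` is `p ξ` for
some `ξ ∈ Q`. -/
def CodedMem {V W : Type u} (ι : W → Set (Set V)) (q : (V → Set V) × (V → Set V) × Set V)
    (w : W) : Prop :=
  ∃ ξ ∈ q.2.2, q.1 ⁻¹' ι w = q.2.1 ξ

theorem exists_code {V W : Type u} {ι : W → Set (Set V)} (hι : Function.Injective ι)
    (hV : ℵ₀ ≤ #V) {P N : Set W} (hP : #P ≤ #V) (hN : #N ≤ #V) (h : Disjoint P N) :
    ∃ q, (∀ w ∈ P, CodedMem ι q w) ∧ ∀ w ∈ N, ¬ CodedMem ι q w := by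
  have hprod : #(P × N) ≤ #V := by
    rw [mk_prod, lift_id, lift_id]
    exact (mul_le_mul' hP hN).trans (mul_eq_self hV).le
  obtain ⟨g⟩ := hprod
  obtain ⟨g'⟩ := hP
  have hA : ∀ x : P × N, ∃ A : Set V, ¬ (A ∈ ι x.1 ↔ A ∈ ι x.2) := by
    intro x
    by_contra! hx
    exact h.ne_of_mem x.1.2 x.2.2 (hι (Set.ext hx))
  choose A hA using hA
  let c : V → Set V := Function.extend g A fun _ => ∅
  let p : V → Set V := Function.extend g' (fun w => c ⁻¹' ι w) fun _ => ∅
  have hp : ∀ w : P, p (g' w) = c ⁻¹' ι w := fun w => g'.injective.extend_apply _ _ w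
  refine ⟨(c, p, Set.range g'), fun w hw => ⟨g' ⟨w, hw⟩, ⟨_, rfl⟩, (hp ⟨w, hw⟩).symm⟩, ?_⟩
  rintro w hw ⟨_, ⟨v, rfl⟩, hv⟩
  refine hA (v, ⟨w, hw⟩) ?_
  have hc : c (g (v, ⟨w, hw⟩)) = A (v, ⟨w, hw⟩) := g.injective.extend_apply _ _ _
  have htrace : c (g (v, ⟨w, hw⟩)) ∈ ι w ↔ c (g (v, ⟨w, hw⟩)) ∈ ι v :=
    Set.ext_iff.1 (hv.trans (hp v)) (g (v, ⟨w, hw⟩))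
  rw [hc] at htrace
  exact htrace.symm

theorem mk_le_of_separated_of_mk_le {κ : Cardinal.{u}} (hκ : ℵ₀ ≤ κ) {J W : Type u}
    (hW : #W ≤ 2 ^ (2 ^ κ : Cardinal.{u})) {P N : J → Set W} (hP : ∀ k, #(P k) ≤ κ)
    (hN : ∀ k, #(N k) ≤ κ) (hPN : ∀ k, Disjoint (P k) (N k))
    (hsep : ∀ k k', k ≠ k' → ¬ (Disjoint (P k) (N k') ∧ Disjoint (P k') (N k))) :
    #J ≤ 2 ^ κ := by
  obtain ⟨V, hV⟩ : ∃ V : Type u, #V = κ := ⟨κ.out, mk_out κ⟩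
  obtain ⟨ι⟩ : Nonempty (W ↪ Set (Set V)) := by
    rw [← le_def, mk_set, mk_set, hV]
    exact hW
  choose q hq hq' using fun k => exists_code ι.injective (hκ.trans_eq hV.symm)
    ((hP k).trans_eq hV.symm) ((hN k).trans_eq hV.symm) (hPN k)
  have hinj : Function.Injective q := by
    intro k k' h
    by_contra hne
    refine hsep k k' hne ⟨Set.disjoint_left.2 fun w hw hw' => ?_,
      Set.disjoint_left.2 fun w hw hw' => ?_⟩
    · exact hq' k' w hw' (h ▸ hq k w hw)
    · exact hq' k w hw' (h ▸ hq k' w hw)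
  refine (mk_le_of_injective hinj).trans (le_of_eq ?_)
  have h2 : ℵ₀ ≤ (2 ^ κ : Cardinal.{u}) := hκ.trans (cantor κ).le
  have hfun : #(V → Set V) = 2 ^ κ := by
    rw [← power_def, mk_set, hV, ← power_mul, mul_eq_self hκ]
  simp only [mk_prod, lift_id]
  rw [hfun, mk_set, hV, mul_eq_self h2, mul_eq_self h2]

/-- A family of pairs of sets of size at most `κ`, separating each other, has size at most
`2 ^ κ`. -/
theorem mk_le_of_separated {κ : Cardinal.{u}} (hκ : ℵ₀ ≤ κ) {J W : Type u} {P N : J → Set W}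
    (hP : ∀ k, #(P k) ≤ κ) (hN : ∀ k, #(N k) ≤ κ) (hPN : ∀ k, Disjoint (P k) (N k))
    (hsep : ∀ k k', k ≠ k' → ¬ (Disjoint (P k) (N k') ∧ Disjoint (P k') (N k))) :
    #J ≤ 2 ^ κ := by
  by_contra hlt
  rw [not_le, ← Order.succ_le_iff, le_mk_iff_exists_set] at hlt
  obtain ⟨T, hT⟩ := hlt
  have hinf : ℵ₀ ≤ Order.succ (2 ^ κ : Cardinal.{u}) :=
    hκ.trans ((cantor κ).le.trans (Order.le_succ _))
  let W' : Set W := ⋃ k : T, P k ∪ N k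
  have hPW : ∀ k : T, P k ⊆ W' := fun k => Set.subset_iUnion_of_subset k Set.subset_union_left
  have hNW : ∀ k : T, N k ⊆ W' := fun k => Set.subset_iUnion_of_subset k Set.subset_union_right
  have hW' : #W' ≤ 2 ^ (2 ^ κ : Cardinal.{u}) := by
    refine le_trans ?_ (Order.succ_le_of_lt (cantor (2 ^ κ)))
    refine (mk_iUnion_le_sum_mk).trans <| (sum_le_sum _ (fun _ => κ) fun k : T =>
      (mk_union_le _ _).trans (add_le_of_le hκ (hP k) (hN k))).trans ?_
    rw [sum_const', hT]
    exact (mul_le_mul' le_rfl ((cantor κ).le.trans (Order.le_succ _))).trans (mul_eq_self hinf).le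
  have hdisj : ∀ {X Y : Set W}, X ⊆ W' →
      Disjoint (Subtype.val ⁻¹' X : Set W') (Subtype.val ⁻¹' Y) → Disjoint X Y :=
    fun hX h => Set.disjoint_left.2 fun w hwX hwY =>
      h.ne_of_mem (a := ⟨w, hX hwX⟩) (b := ⟨w, hX hwX⟩) hwX hwY rfl
  have := mk_le_of_separated_of_mk_le (J := T) hκ hW' (P := fun k : T => Subtype.val ⁻¹' P k)
    (N := fun k : T => Subtype.val ⁻¹' N k)
    (fun k => (mk_preimage_of_injective _ _ Subtype.val_injective).trans (hP k))
    (fun k => (mk_preimage_of_injective _ _ Subtype.val_injective).trans (hN k))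
    (fun k => (hPN k).preimage _)
    (fun k k' hne h => hsep k k' (fun h => hne (Subtype.ext h))
      ⟨hdisj (hPW k) h.1, hdisj (hPW k') h.2⟩)
  rw [hT] at this
  exact (Order.lt_succ_of_not_isMax (not_isMax _)).not_ge this

variable {K : Type u} [LinearOrder K] {D : K → Type u} {Λ : Type u}

/-- The nodes on the branches in `s`, labelled by `f`. -/
def nodeLabels (η : Λ → ∀ i, D i × D i) (f : Λ → ∀ i, D i) (s : Set Λ) :
    Set (Σ i, LevelNode D i × D i) :=
  {x | ∃ α ∈ s, ∃ i, ⟨i, branchNode (η α) i, f α i⟩ = x}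

theorem disjoint_nodeLabels_iff {η : Λ → ∀ i, D i × D i} {f g : Λ → ∀ i, D i} {s t : Set Λ} :
    Disjoint (nodeLabels η f s) (nodeLabels η g t) ↔
      ∀ α ∈ s, ∀ β ∈ t, ¬ ∃ i, (∀ j < i, η α j = η β j) ∧ f α i = g β i := by
  constructor
  · rintro h α hα β hβ ⟨i, hi, hfg⟩
    refine Set.disjoint_left.1 h ⟨α, hα, i, rfl⟩ ⟨β, hβ, i, ?_⟩
    rw [branchNode_eq_iff.2 hi, hfg]
  · intro h
    refine Set.disjoint_left.2 ?_
    rintro _ ⟨α, hα, i, rfl⟩ ⟨β, hβ, i', h'⟩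
    obtain rfl : i' = i := congrArg Sigma.fst h'
    simp only [Sigma.mk.injEq, heq_eq_eq, true_and, Prod.mk.injEq] at h'
    exact h α hα β hβ ⟨i', branchNode_eq_iff.1 h'.1.symm, h'.2.symm⟩

theorem mk_nodeLabels_le {κ : Cardinal.{u}} (hκ : ℵ₀ ≤ κ) (hK : #K ≤ κ)
    (η : Λ → ∀ i, D i × D i) (f : Λ → ∀ i, D i) {s : Set Λ} (hs : #s ≤ κ) :
    #(nodeLabels η f s) ≤ κ := by
  have : nodeLabels η f s = Set.range fun q : s × K =>
      (⟨q.2, branchNode (η q.1) q.2, f q.1 q.2⟩ : Σ i, LevelNode D i × D i) := by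
    ext x
    simp [nodeLabels]
  rw [this]
  refine mk_range_le.trans ?_
  rw [mk_prod, lift_id, lift_id]
  exact (mul_le_mul' hs hK).trans (mul_eq_self hκ).le

theorem mk_le_of_not_compatible {κ : Cardinal.{u}} (hκ : ℵ₀ ≤ κ) (hK : #K ≤ κ)
    {η : Λ → ∀ i, D i × D i} (hdiag : ∀ α i, (η α i).1 ≠ (η α i).2) {M : Set Λ} {J : Type u}
    {s t : J → Finset Λ}
    (hs : ∀ j, (s j : Set Λ).Pairwise fun α β => ¬ (BranchAdj η α β ∧ α ∉ M ∧ β ∉ M))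
    (hst : ∀ j, Disjoint (s j) (t j))
    (hsep : ∀ j j', j ≠ j' →
      ¬ Compatible (fun α β => ¬ (BranchAdj η α β ∧ α ∉ M ∧ β ∉ M)) (s j) (t j) (s j') (t j')) :
    #J ≤ 2 ^ κ := by
  let P : J → Set ((Σ i, LevelNode D i × D i) ⊕ Λ) := fun j =>
    Sum.inl '' nodeLabels η (fun α i => (η α i).1) (↑(s j) \ M) ∪ Sum.inr '' (s j : Set Λ)
  let N : J → Set ((Σ i, LevelNode D i × D i) ⊕ Λ) := fun j =>
    Sum.inl '' nodeLabels η (fun α i => (η α i).2) (↑(s j) \ M) ∪ Sum.inr '' (t j : Set Λ)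
  have hfin : ∀ r : Finset Λ, #(r : Set Λ) ≤ κ := fun r => r.finite_toSet.lt_aleph0.le.trans hκ
  have hdiff : ∀ j, #(↑(s j) \ M : Set Λ) ≤ κ := fun j =>
    (mk_le_mk_of_subset Set.sdiff_subset).trans (hfin _)
  have hdisj : ∀ j j', Disjoint (P j) (N j') ↔ Disjoint (s j) (t j') ∧
      ∀ α ∈ (s j : Set Λ) \ M, ∀ β ∈ (s j' : Set Λ) \ M,
        ¬ ∃ i, (∀ k < i, η α k = η β k) ∧ (η α i).1 = (η β i).2 := by
    intro j j'
    rw [← disjoint_nodeLabels_iff (f := fun α i => (η α i).1) (g := fun α i => (η α i).2),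
      Set.disjoint_union_left, Set.disjoint_union_right, Set.disjoint_union_right,
      Set.disjoint_image_iff Sum.inl_injective, Set.disjoint_image_iff Sum.inr_injective,
      Finset.disjoint_coe]
    have h₁ : ∀ (X : Set (Σ i, LevelNode D i × D i)) (Y : Set Λ),
        Disjoint (Sum.inl '' X) (Sum.inr '' Y) := fun X Y =>
      Set.disjoint_left.2 (by rintro _ ⟨x, -, rfl⟩ ⟨y, -, h⟩; cases h)
    simp only [h₁, fun X Y => (h₁ X Y).symm, and_true, true_and]
    exact and_comm
  refine mk_le_of_separated hκ (P := P) (N := N)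
    (fun j => (mk_union_le _ _).trans (add_le_of_le hκ
      (mk_image_le.trans (mk_nodeLabels_le hκ hK _ _ (hdiff j))) (mk_image_le.trans (hfin _))))
    (fun j => (mk_union_le _ _).trans (add_le_of_le hκ
      (mk_image_le.trans (mk_nodeLabels_le hκ hK _ _ (hdiff j))) (mk_image_le.trans (hfin _))))
    (fun j => (hdisj j j).2 ⟨hst j, ?_⟩) fun j j' hne h => hsep j j' hne ?_
  · rintro α hα β hβ ⟨i, hi, h⟩
    by_cases hαβ : α = β
    · subst hαβ
      exact hdiag α i h
    · exact hs j hα.1 hβ.1 hαβ ⟨⟨i, hi, .inr h.symm⟩, hα.2, hβ.2⟩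
  · rw [hdisj, hdisj] at h
    have hcross : ∀ α ∈ s j, ∀ β ∈ s j', ¬ (BranchAdj η α β ∧ α ∉ M ∧ β ∉ M) := by
      rintro α hα β hβ ⟨⟨i, hi, hedge | hedge⟩, hαM, hβM⟩
      · exact h.2.2 β ⟨hβ, hβM⟩ α ⟨hα, hαM⟩ ⟨i, fun k hk => (hi k hk).symm, hedge.symm⟩
      · exact h.1.2 α ⟨hα, hαM⟩ β ⟨hβ, hβM⟩ ⟨i, hi, hedge.symm⟩
    refine ⟨?_, h.1.1, h.2.1⟩
    rintro α (hα | hα) β (hβ | hβ) hαβ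
    · exact hs j hα hβ hαβ
    · exact hcross α hα β hβ
    · exact fun hR => hcross β hβ α hα ⟨hR.1.symm, hR.2.2, hR.2.1⟩
    · exact hs j' hα hβ hαβ

end Separation

section Cellularity

theorem IsCellularFamily.mk_le_cellularity {X : Type u} [TopologicalSpace X] {S : Set (Set X)}
    (hS : IsCellularFamily S) : #S ≤ cellularity X := by
  refine le_csSup ⟨#(Set X), ?_⟩ ⟨S, hS, rfl⟩
  rintro _ ⟨T, -, rfl⟩
  exact mk_set_le T

theorem mk_le_cellularity {X ι : Type u} [TopologicalSpace X] {U : ι → Set X}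
    (hU : ∀ i, IsOpen (U i)) (hne : ∀ i, (U i).Nonempty)
    (hdisj : Pairwise (Function.onFun Disjoint U)) : #ι ≤ cellularity X := by
  have hinj : Function.Injective U := by
    intro i j h
    by_contra hij
    have hd : Disjoint (U i) (U j) := hdisj hij
    rw [h, disjoint_self] at hd
    exact (hne j).ne_empty hd
  rw [← mk_range_eq U hinj]
  refine IsCellularFamily.mk_le_cellularity ⟨?_, ?_⟩
  · rintro _ ⟨i, rfl⟩
    exact ⟨hU i, hne i⟩
  · rintro _ ⟨i, rfl⟩ _ ⟨j, rfl⟩ hij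
    exact hdisj fun h => hij (h ▸ rfl)

variable {V : Type u}

/-- The space of characteristic functions of cliques of `R`. -/
abbrev CliqueSpace (R : V → V → Prop) : Type u :=
  {f : V → Bool // ∀ a b, f a = true → f b = true → a ≠ b → R a b}

instance (R : V → V → Prop) : CompactSpace (CliqueSpace R) := by
  refine isCompact_iff_compactSpace.1 (IsClosed.isCompact (s := {f : V → Bool | _}) ?_)
  simp only [Set.ofPred_forall]
  refine isClosed_iInter fun a => isClosed_iInter fun b => ?_
  exact (isClosed_discrete {x : Bool × Bool | x.1 = true → x.2 = true → a ≠ b → R a b}).preimage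
    (f := fun f : V → Bool => (f a, f b)) (by fun_prop)

variable {R : V → V → Prop}

/-- The cliques containing `s` and disjoint from `t`. -/
def cylinder (R : V → V → Prop) (s t : Finset V) : Set (CliqueSpace R) :=
  {f | (∀ v ∈ s, f.1 v = true) ∧ ∀ v ∈ t, f.1 v = false}

theorem isOpen_setOf_apply_eq_true (R : V → V → Prop) (v : V) :
    IsOpen {f : CliqueSpace R | f.1 v = true} :=
  (isOpen_discrete {true}).preimage (f := fun f : CliqueSpace R => f.1 v)
    ((continuous_apply v).comp continuous_subtype_val)

theorem exists_apply_eq_true (R : V → V → Prop) (v : V) : ∃ f : CliqueSpace R, f.1 v = true := by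
  classical
  refine ⟨⟨fun w => decide (w = v), fun a b ha hb hab => ?_⟩, by simp⟩
  rw [decide_eq_true_eq] at ha hb
  exact absurd (ha.trans hb.symm) hab

theorem exists_cylinder_subset {U : Set (CliqueSpace R)} (hU : IsOpen U) {f : CliqueSpace R}
    (hf : f ∈ U) : ∃ s t, f ∈ cylinder R s t ∧ cylinder R s t ⊆ U := by
  classical
  obtain ⟨O, hO, rfl⟩ := isOpen_induced_iff.1 hU
  obtain ⟨I, u, hu, hsub⟩ := isOpen_pi_iff.1 hO f.1 hf
  refine ⟨I.filter fun v => f.1 v = true, I.filter fun v => f.1 v = false, ?_, fun g hg => ?_⟩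
  · exact ⟨fun v hv => (Finset.mem_filter.1 hv).2, fun v hv => (Finset.mem_filter.1 hv).2⟩
  · refine hsub fun v hv => ?_
    have : g.1 v = f.1 v := by
      cases h : f.1 v
      · exact hg.2 v (Finset.mem_filter.2 ⟨hv, h⟩)
      · exact hg.1 v (Finset.mem_filter.2 ⟨hv, h⟩)
    rw [this]
    exact (hu v hv).2

theorem pairwise_of_mem_cylinder {s t : Finset V} {f : CliqueSpace R} (hf : f ∈ cylinder R s t) :
    (s : Set V).Pairwise R :=
  fun a ha b hb hab => f.2 a b (hf.1 a ha) (hf.1 b hb) hab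

theorem disjoint_of_mem_cylinder {s t : Finset V} {f : CliqueSpace R}
    (hf : f ∈ cylinder R s t) : Disjoint s t :=
  Finset.disjoint_left.2 fun v hs ht => by simpa [hf.1 v hs] using hf.2 v ht

theorem Compatible.cylinder_inter_nonempty {s t s' t' : Finset V} (h : Compatible R s t s' t')
    (hst : Disjoint s t) (hst' : Disjoint s' t') :
    (cylinder R s t ∩ cylinder R s' t').Nonempty := by
  classical
  refine ⟨⟨fun v => decide (v ∈ s ∨ v ∈ s'), fun a b ha hb hab => ?_⟩, ⟨fun v hv => ?_,
    fun v hv => ?_⟩, fun v hv => ?_, fun v hv => ?_⟩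
  · rw [decide_eq_true_eq] at ha hb
    exact h.1 ha hb hab
  · simp [hv]
  · simp [Finset.disjoint_right.1 hst hv, Finset.disjoint_right.1 h.2.2 hv]
  · simp [hv]
  · simp [Finset.disjoint_right.1 hst' hv, Finset.disjoint_right.1 h.2.1 hv]

theorem cellularity_cliqueSpace_le {χ : Cardinal.{u}}
    (h : ∀ (J : Type u) (s t : J → Finset V), (∀ j, (s j : Set V).Pairwise R) →
      (∀ j, Disjoint (s j) (t j)) →
      (∀ j j', j ≠ j' → ¬ Compatible R (s j) (t j) (s j') (t j')) → #J ≤ χ) :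
    cellularity (CliqueSpace R) ≤ χ := by
  refine csSup_le' ?_
  rintro _ ⟨S, ⟨hopen, hdisj⟩, rfl⟩
  choose f hf using fun U : S => (hopen U U.2).2
  choose s t hfst hsub using fun U : S => exists_cylinder_subset (hopen U U.2).1 (hf U)
  refine h S s t (fun U => pairwise_of_mem_cylinder (hfst U))
    (fun U => disjoint_of_mem_cylinder (hfst U)) fun U U' hne hcomp => ?_
  obtain ⟨g, hg, hg'⟩ := hcomp.cylinder_inter_nonempty (disjoint_of_mem_cylinder (hfst U))
    (disjoint_of_mem_cylinder (hfst U'))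
  exact Set.disjoint_left.1 (hdisj U.2 U'.2 fun h => hne (Subtype.ext h)) (hsub U hg) (hsub U' hg')

theorem cellularity_prod_cliqueSpace_le [Infinite V] (R R' : V → V → Prop) :
    cellularity (CliqueSpace R × CliqueSpace R') ≤ #V := by
  refine csSup_le' ?_
  rintro _ ⟨S, ⟨hopen, hdisj⟩, rfl⟩
  have hex : ∀ U : S, ∃ q : (Finset V × Finset V) × Finset V × Finset V,
      (cylinder R q.1.1 q.1.2 ×ˢ cylinder R' q.2.1 q.2.2).Nonempty ∧
        cylinder R q.1.1 q.1.2 ×ˢ cylinder R' q.2.1 q.2.2 ⊆ U.1 := by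
    intro U
    obtain ⟨⟨f, g⟩, hfg⟩ := (hopen U U.2).2
    obtain ⟨A, B, hA, hB, hfA, hgB, hAB⟩ := isOpen_prod_iff.1 (hopen U U.2).1 f g hfg
    obtain ⟨s, t, hf, hst⟩ := exists_cylinder_subset hA hfA
    obtain ⟨s', t', hg, hst'⟩ := exists_cylinder_subset hB hgB
    exact ⟨((s, t), s', t'), ⟨(f, g), hf, hg⟩, (Set.prod_mono hst hst').trans hAB⟩
  choose q hne hsub using hex
  have hinj : Function.Injective q := by
    intro U U' h
    by_contra hUU'
    obtain ⟨x, hx⟩ := hne U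
    exact Set.disjoint_left.1 (hdisj U.2 U'.2 fun h => hUU' (Subtype.ext h)) (hsub U hx)
      (hsub U' (h ▸ hx))
  refine (mk_le_of_injective hinj).trans_eq ?_
  simp only [mk_prod, lift_id, mk_finset_of_infinite, mul_eq_self (aleph0_le_mk V)]

theorem mk_le_cellularity_prod_cliqueSpace (R : V → V → Prop) :
    #V ≤ cellularity (CliqueSpace R × CliqueSpace fun a b => ¬ R a b) := by
  refine mk_le_cellularity (U := fun v => {f : CliqueSpace R | f.1 v = true} ×ˢ
    {g : CliqueSpace fun a b => ¬ R a b | g.1 v = true}) (fun v => ?_) (fun v => ?_)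
    fun v w hvw => ?_
  · exact (isOpen_setOf_apply_eq_true R v).prod (isOpen_setOf_apply_eq_true _ v)
  · obtain ⟨f, hf⟩ := exists_apply_eq_true R v
    obtain ⟨g, hg⟩ := exists_apply_eq_true (fun a b => ¬ R a b) v
    exact ⟨(f, g), hf, hg⟩
  · exact Set.disjoint_left.2 fun x hx hx' =>
      x.2.2 v w hx.2 hx'.2 hvw (x.1.2 v w hx.1 hx'.1 hvw)

theorem mk_le_cellularity_cliqueSpace {M : Set V} (hM : M.Pairwise fun a b => ¬ R a b) :
    #M ≤ cellularity (CliqueSpace R) := by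
  refine mk_le_cellularity (U := fun v : M => {f : CliqueSpace R | f.1 v = true})
    (fun v => isOpen_setOf_apply_eq_true R v) (fun v => exists_apply_eq_true R v) fun v w hvw => ?_
  have hne : v.1 ≠ w.1 := fun h => hvw (Subtype.ext h)
  exact Set.disjoint_left.2 fun f hf hf' => hM v.2 w.2 hne (f.2 v w hf hf' hne)

end Cellularity

theorem stmt_7 (μ : Cardinal.{u}) (hμ : ℵ₀ ≤ μ) (hsing : μ.ord.cof < μ)
    (hsl : ∀ ν : Cardinal.{u}, ν < μ → 2 ^ ν < μ) (hch : 2 ^ μ = Order.succ μ) :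
    ∃ (X Y : Type u) (_ : TopologicalSpace X) (_ : TopologicalSpace Y),
      CompactSpace X ∧ T2Space X ∧ TotallyDisconnectedSpace X ∧
      CompactSpace Y ∧ T2Space Y ∧ TotallyDisconnectedSpace Y ∧
      cellularity X = μ ∧ cellularity Y < Order.succ (2 ^ μ.ord.cof) ∧
      cellularity (X × Y) = Order.succ μ := by
  obtain ⟨K, _, D, Λ, η, hK, hΛ, hdiag, hcore⟩ := exists_branches hμ hsing hsl hch
  have hcof : ℵ₀ ≤ μ.ord.cof := Ordinal.aleph0_le_cof_iff.2
    (Ordinal.one_lt_cof_iff.2 (isSuccLimit_ord hμ))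
  have : Infinite Λ := infinite_iff.2 (hΛ ▸ hμ.trans (Order.le_succ μ))
  obtain ⟨M, hM⟩ := le_mk_iff_exists_set.1 (hΛ ▸ Order.le_succ μ)
  let R : Λ → Λ → Prop := fun α β => BranchAdj η α β ∧ α ∉ M ∧ β ∉ M
  refine ⟨CliqueSpace R, CliqueSpace fun α β => ¬ R α β, inferInstance, inferInstance,
    inferInstance, inferInstance, inferInstance, inferInstance, inferInstance, inferInstance,
    le_antisymm ?_ ?_, Order.lt_succ_of_le ?_, le_antisymm ?_ ?_⟩
  · refine cellularity_cliqueSpace_le fun J s t hs hst hsep => ?_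
    by_contra hlt
    obtain ⟨j, j', hne, h⟩ := exists_compatible hμ (fun _ _ => BranchAdj.symm) hM.le hcore
      (not_le.1 hlt) hs hst
    exact hsep j j' hne h
  · rw [← hM]
    exact mk_le_cellularity_cliqueSpace fun α hα β _ _ h => h.2.1 hα
  · exact cellularity_cliqueSpace_le fun J s t hs hst hsep =>
      mk_le_of_not_compatible hcof hK.le hdiag hs hst hsep
  · exact (cellularity_prod_cliqueSpace_le _ _).trans_eq hΛ
  · exact hΛ.symm.trans_le (mk_le_cellularity_prod_cliqueSpace R)
end

section
/- For every infinite cardinal κ and every infinite Boolean algebra A: if c(A) ≥ κ⁺⁺ and A has a Boolean subalgebra B with |B| = κ⁺⁺ and c(B) = κ, then A has a Boolean subalgebra B' with |B'| = κ⁺⁺ and c(B') = κ⁺. -/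
universe u

open Cardinal

/-- A Boolean subalgebra of `A`, as a subset containing `⊥` and `⊤` and closed under
`⊓`, `⊔` and complementation. -/
structure IsBoolSubalgebra {A : Type u} [BooleanAlgebra A] (S : Set A) : Prop where
  bot_mem : ⊥ ∈ S
  top_mem : ⊤ ∈ S
  inf_mem : ∀ x ∈ S, ∀ y ∈ S, x ⊓ y ∈ S
  sup_mem : ∀ x ∈ S, ∀ y ∈ S, x ⊔ y ∈ S
  compl_mem : ∀ x ∈ S, xᶜ ∈ S

/-- The cellularity of the Boolean algebra `A`: the supremum of the cardinalities of
sets of pairwise disjoint nonzero elements. -/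
noncomputable def cellularityBA (A : Type u) [BooleanAlgebra A] : Cardinal.{u} :=
  sSup {μ : Cardinal.{u} | ∃ T : Set A,
    (∀ x ∈ T, x ≠ ⊥) ∧ T.PairwiseDisjoint id ∧ #T = μ}

/-- The cellularity of the subalgebra of `A` with underlying set `S` (computed with the
induced operations, i.e. with the disjointness and `⊥` of `A`). -/
noncomputable def cellularityOn {A : Type u} [BooleanAlgebra A] (S : Set A) : Cardinal.{u} :=
  sSup {μ : Cardinal.{u} | ∃ T : Set A, T ⊆ S ∧
    (∀ x ∈ T, x ≠ ⊥) ∧ T.PairwiseDisjoint id ∧ #T = μ}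

namespace IsBoolSubalgebra

variable {A : Type u} [BooleanAlgebra A] {S : Set A}

/-- The elements of `A` that agree below `c` with an element of `S`. -/
def agreeBelow (S : Set A) (c : A) : Set A := {x | ∃ b ∈ S, x ⊓ c = b ⊓ c}

theorem subset_agreeBelow (S : Set A) (c : A) : S ⊆ agreeBelow S c :=
  fun x hx => ⟨x, hx, rfl⟩

theorem agreeBelow_anti {c d : A} (h : d ≤ c) : agreeBelow S c ⊆ agreeBelow S d := by
  rintro x ⟨b, hb, hxb⟩
  refine ⟨b, hb, ?_⟩
  rw [← inf_eq_right.2 h, ← inf_assoc, ← inf_assoc, hxb]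

theorem agreeBelow_isBoolSubalgebra (hS : IsBoolSubalgebra S) (c : A) :
    IsBoolSubalgebra (agreeBelow S c) where
  bot_mem := subset_agreeBelow S c hS.bot_mem
  top_mem := subset_agreeBelow S c hS.top_mem
  inf_mem := by
    rintro x ⟨b, hb, hx⟩ y ⟨b', hb', hy⟩
    refine ⟨b ⊓ b', hS.inf_mem _ hb _ hb', ?_⟩
    rw [inf_inf_distrib_right, hx, hy, ← inf_inf_distrib_right]
  sup_mem := by
    rintro x ⟨b, hb, hx⟩ y ⟨b', hb', hy⟩
    refine ⟨b ⊔ b', hS.sup_mem _ hb _ hb', ?_⟩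
    rw [inf_sup_right, hx, hy, ← inf_sup_right]
  compl_mem := by
    rintro x ⟨b, hb, hx⟩
    refine ⟨bᶜ, hS.compl_mem _ hb, ?_⟩
    have key : ∀ z : A, zᶜ ⊓ c = (z ⊓ c)ᶜ ⊓ c := fun z => by
      rw [compl_inf, inf_sup_right, compl_inf_self, sup_bot_eq]
    rw [key, hx, ← key]

/-- The subalgebra generated by a subalgebra `S` and a set `E` of pairwise disjoint elements. -/
def adjoin (S E : Set A) : Set A :=
  {x | ∃ F : Finset E, x ∈ agreeBelow S (F.sup Subtype.val)ᶜ ∧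
    ∀ e : E, x ∈ agreeBelow S (e : A)}

theorem subset_adjoin (S E : Set A) : S ⊆ adjoin S E :=
  fun _ hx => ⟨∅, subset_agreeBelow S _ hx, fun _ => subset_agreeBelow S _ hx⟩

theorem subset_adjoin_right (hS : IsBoolSubalgebra S) {E : Set A}
    (hE : E.PairwiseDisjoint id) : E ⊆ adjoin S E := by
  intro x hx
  refine ⟨{⟨x, hx⟩}, ⟨⊥, hS.bot_mem, by simp⟩, fun e => ?_⟩
  by_cases h : x = e
  · exact ⟨⊤, hS.top_mem, by simp [h]⟩
  · exact ⟨⊥, hS.bot_mem, by simpa using (hE hx e.2 h).eq_bot⟩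

theorem adjoin_isBoolSubalgebra (hS : IsBoolSubalgebra S) (E : Set A) :
    IsBoolSubalgebra (adjoin S E) := by
  classical
  have left (F G : Finset E) {x : A} (hx : x ∈ agreeBelow S (F.sup Subtype.val)ᶜ) :
      x ∈ agreeBelow S ((F ∪ G).sup Subtype.val)ᶜ :=
    agreeBelow_anti (compl_le_compl (Finset.sup_mono Finset.subset_union_left)) hx
  have right (F G : Finset E) {x : A} (hx : x ∈ agreeBelow S (G.sup Subtype.val)ᶜ) :
      x ∈ agreeBelow S ((F ∪ G).sup Subtype.val)ᶜ :=
    agreeBelow_anti (compl_le_compl (Finset.sup_mono Finset.subset_union_right)) hx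
  refine ⟨subset_adjoin S E hS.bot_mem, subset_adjoin S E hS.top_mem, ?_, ?_, ?_⟩
  · rintro x ⟨F, hx, hx'⟩ y ⟨G, hy, hy'⟩
    exact ⟨F ∪ G, (hS.agreeBelow_isBoolSubalgebra _).inf_mem _ (left F G hx) _ (right F G hy),
      fun e => (hS.agreeBelow_isBoolSubalgebra _).inf_mem _ (hx' e) _ (hy' e)⟩
  · rintro x ⟨F, hx, hx'⟩ y ⟨G, hy, hy'⟩
    exact ⟨F ∪ G, (hS.agreeBelow_isBoolSubalgebra _).sup_mem _ (left F G hx) _ (right F G hy),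
      fun e => (hS.agreeBelow_isBoolSubalgebra _).sup_mem _ (hx' e) _ (hy' e)⟩
  · rintro x ⟨F, hx, hx'⟩
    exact ⟨F, (hS.agreeBelow_isBoolSubalgebra _).compl_mem _ hx,
      fun e => (hS.agreeBelow_isBoolSubalgebra _).compl_mem _ (hx' e)⟩

theorem eq_sup_of_inf_compl_eq {E : Set A} {x b : A} {F : Finset E} {f : E → A}
    (hb : x ⊓ (F.sup Subtype.val)ᶜ = b ⊓ (F.sup Subtype.val)ᶜ)
    (hf : ∀ e : E, x ⊓ e = f e ⊓ e) :
    x = b ⊓ (F.sup Subtype.val)ᶜ ⊔ F.sup (fun e => f e ⊓ (e : A)) := by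
  rw [← hb, ← Finset.sup_congr rfl (fun e _ => hf e), ← Finset.sup_inf_distrib_left,
    ← inf_sup_left, sup_comm, sup_compl_eq_top, inf_top_eq]

theorem mk_adjoin_le {E : Set A} {c : Cardinal.{u}} (hc : ℵ₀ ≤ c) (hS : #S ≤ c) (hE : #E ≤ c) :
    #(adjoin S E) ≤ c := by
  classical
  let g : Finset (E × S) × S → A := fun p =>
    (p.2 : A) ⊓ (p.1.sup fun q => (q.1 : A))ᶜ ⊔ p.1.sup fun q => (q.2 : A) ⊓ (q.1 : A)
  have hsub : adjoin S E ⊆ Set.range g := by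
    rintro x ⟨F, ⟨b, hb, hxb⟩, h⟩
    choose f hfS hf using h
    refine ⟨(F.image fun e => (e, ⟨f e, hfS e⟩), ⟨b, hb⟩), ?_⟩
    rw [eq_sup_of_inf_compl_eq hxb hf]
    simp only [g, Finset.sup_image]
    rfl
  have hprod : #(E × S) ≤ c := by
    rw [mk_prod, lift_id, lift_id]
    exact (mul_le_mul' hE hS).trans (mul_eq_self hc).le
  have hfin : #(Finset (E × S)) ≤ c := by
    rcases finite_or_infinite (E × S) with h | h
    · exact (lt_aleph0_of_finite _).le.trans hc
    · rwa [mk_finset_of_infinite]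
  calc #(adjoin S E) ≤ #(Set.range g) := mk_le_mk_of_subset hsub
    _ ≤ #(Finset (E × S) × S) := mk_range_le
    _ ≤ c := by
      rw [mk_prod, lift_id, lift_id]
      exact (mul_le_mul' hfin hS).trans (mul_eq_self hc).le

theorem exists_inf_ne_bot_of_mem_adjoin {E : Set A} {x : A} (hx : x ∈ adjoin S E)
    (hx0 : x ≠ ⊥) :
    ∃ i : E ⊕ Finset E, ∃ b ∈ S,
      x ⊓ Sum.elim Subtype.val (fun F => (F.sup Subtype.val)ᶜ) i =
        b ⊓ Sum.elim Subtype.val (fun F => (F.sup Subtype.val)ᶜ) i ∧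
      b ⊓ Sum.elim Subtype.val (fun F => (F.sup Subtype.val)ᶜ) i ≠ ⊥ := by
  obtain ⟨F, ⟨b, hb, hxb⟩, h⟩ := hx
  by_cases h0 : b ⊓ (F.sup Subtype.val)ᶜ = ⊥
  · choose f hfS hf using h
    have hx := eq_sup_of_inf_compl_eq hxb hf
    by_contra! hcon
    refine hx0 (hx.trans ?_)
    rw [h0, bot_sup_eq, Finset.sup_eq_bot_iff]
    exact fun e _ => hcon (Sum.inl e) (f e) (hfS e) (hf e)
  · exact ⟨Sum.inr F, b, hb, hxb, h0⟩

end IsBoolSubalgebra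

section Cellularity

variable {A : Type u} [BooleanAlgebra A] {S : Set A}

theorem mk_le_cellularityOn {T : Set A} (hTS : T ⊆ S) (h0 : ∀ x ∈ T, x ≠ ⊥)
    (hT : T.PairwiseDisjoint id) : #T ≤ cellularityOn S := by
  refine le_csSup ⟨#A, ?_⟩ ⟨T, hTS, h0, hT, rfl⟩
  rintro _ ⟨T, -, -, -, rfl⟩
  exact mk_set_le T

/-- A family indexed by `T` of pairwise disjoint nonzero elements of `S` has size at most the
cellularity of `S`. -/
theorem mk_le_cellularityOn_of_family {T : Set A} {f : A → A} (hfS : ∀ x ∈ T, f x ∈ S)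
    (h0 : ∀ x ∈ T, f x ≠ ⊥) (hT : T.PairwiseDisjoint f) : #T ≤ cellularityOn S := by
  have hinj : Set.InjOn f T := fun x hx y hy hxy => by
    by_contra hne
    exact h0 x hx (disjoint_self.1 (by simpa [Function.onFun, hxy] using hT hx hy hne))
  rw [← mk_image_eq_of_injOn f T hinj]
  refine mk_le_cellularityOn ?_ ?_ ?_
  · rintro _ ⟨x, hx, rfl⟩
    exact hfS x hx
  · rintro _ ⟨x, hx, rfl⟩
    exact h0 x hx
  · rintro _ ⟨x, hx, rfl⟩ _ ⟨y, hy, rfl⟩ hne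
    exact hT hx hy fun h => hne (by rw [h])

theorem exists_disjoint_of_lt_cellularityBA {μ : Cardinal.{u}} (h : μ < cellularityBA A) :
    ∃ T : Set A, (∀ x ∈ T, x ≠ ⊥) ∧ T.PairwiseDisjoint id ∧ #T = μ := by
  obtain ⟨_, ⟨T, h0, hT, rfl⟩, hμ⟩ := exists_lt_of_lt_csSup' h
  obtain ⟨T', hT', hcard⟩ := le_mk_iff_exists_subset.1 hμ.le
  exact ⟨T', fun x hx => h0 x (hT' hx), hT.subset hT', hcard⟩

theorem cellularityOn_adjoin {E : Set A} {μ : Cardinal.{u}} (hμ : ℵ₀ ≤ μ)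
    (hS : IsBoolSubalgebra S) (hE : #E = μ) (hE0 : ∀ e ∈ E, e ≠ ⊥)
    (hEd : E.PairwiseDisjoint id)
    (h : ∀ i : E ⊕ Finset E, ∀ T ⊆ S,
      (∀ b ∈ T, b ⊓ Sum.elim Subtype.val (fun F => (F.sup Subtype.val)ᶜ) i ≠ ⊥) →
      T.PairwiseDisjoint (fun b => b ⊓ Sum.elim Subtype.val (fun F => (F.sup Subtype.val)ᶜ) i) →
      #T ≤ μ) :
    cellularityOn (IsBoolSubalgebra.adjoin S E) = μ := by
  refine le_antisymm (csSup_le' ?_)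
    (hE ▸ mk_le_cellularityOn (hS.subset_adjoin_right hEd) hE0 hEd)
  rintro _ ⟨T, hTS, hT0, hTd, rfl⟩
  have key (x : T) := IsBoolSubalgebra.exists_inf_ne_bot_of_mem_adjoin (hTS x.2) (hT0 x x.2)
  choose i b hbS hxb hb0 using key
  have : Infinite E := by rw [infinite_iff, hE]; exact hμ
  have hfib (j : E ⊕ Finset E) : #(i ⁻¹' {j}) ≤ μ := by
    have hdisj : ∀ x ∈ i ⁻¹' {j}, ∀ y ∈ i ⁻¹' {j}, x ≠ y →
        Disjoint (b x ⊓ Sum.elim Subtype.val (fun F => (F.sup Subtype.val)ᶜ) j)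
          (b y ⊓ Sum.elim Subtype.val (fun F => (F.sup Subtype.val)ᶜ) j) := by
      rintro x rfl y (hy : i y = i x) hne
      rw [← hxb x, ← hy, ← hxb y]
      exact (hTd x.2 y.2 (Subtype.coe_injective.ne hne)).mono inf_le_left inf_le_left
    have h0 : ∀ x ∈ i ⁻¹' {j},
        b x ⊓ Sum.elim Subtype.val (fun F => (F.sup Subtype.val)ᶜ) j ≠ ⊥ := by
      rintro x rfl
      exact hb0 x
    have hinj : Set.InjOn b (i ⁻¹' {j}) := fun x hx y hy hxy => by
      by_contra hne
      have := hdisj x hx y hy hne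
      rw [← hxy, disjoint_self] at this
      exact h0 x hx this
    rw [← mk_image_eq_of_injOn b _ hinj]
    refine h j _ ?_ ?_ ?_
    · rintro _ ⟨x, -, rfl⟩
      exact hbS x
    · rintro _ ⟨x, hx, rfl⟩
      exact h0 x hx
    · rintro _ ⟨x, hx, rfl⟩ _ ⟨y, hy, rfl⟩ hne
      exact hdisj x hx y hy fun h => hne (by rw [h])
  calc #T ≤ #(E ⊕ Finset E) * μ := mk_le_mk_mul_of_mk_preimage_le i hfib
    _ = μ := by
      rw [mk_sum, lift_id, lift_id, mk_finset_of_infinite, hE, add_eq_self hμ, mul_eq_self hμ]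

/-- If every element of `S` either contains or is disjoint from each member of the finite
set `F`, then few elements of `S` are nonzero and pairwise disjoint off `F`. -/
theorem mk_le_of_pairwiseDisjoint_inf_compl_sup {E : Set A} {μ : Cardinal.{u}} (hμ : ℵ₀ ≤ μ)
    (hS : IsBoolSubalgebra S) (hcell : cellularityOn S ≤ μ)
    (hES : ∀ b ∈ S, ∀ e ∈ E, e ≤ b ∨ Disjoint b e) (F : Finset E) {T : Set A} (hTS : T ⊆ S)
    (h0 : ∀ b ∈ T, b ⊓ (F.sup Subtype.val)ᶜ ≠ ⊥)
    (hT : T.PairwiseDisjoint fun b => b ⊓ (F.sup Subtype.val)ᶜ) : #T ≤ μ := by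
  classical
  set s : A := F.sup Subtype.val with hs
  have htrace (b : A) (hb : b ∈ S) :
      b ⊓ s = (F.filter fun e : E => (e : A) ≤ b).sup Subtype.val := by
    rw [hs, Finset.sup_inf_distrib_left]
    refine le_antisymm (Finset.sup_le fun e he => ?_) (Finset.sup_le fun e he => ?_)
    · rcases hES b hb e e.2 with h | h
      · exact inf_le_right.trans
          (Finset.le_sup (f := Subtype.val) (Finset.mem_filter.2 ⟨he, h⟩))
      · rw [h.eq_bot]
        exact bot_le
    · rw [Finset.mem_filter] at he
      exact (le_inf he.2 le_rfl).trans (Finset.le_sup (f := fun e : E => b ⊓ (e : A)) he.1)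
  let p : T → F.powerset := fun b =>
    ⟨F.filter fun e : E => (e : A) ≤ b, Finset.mem_powerset.2 (Finset.filter_subset _ _)⟩
  have hfib (G : F.powerset) : #(p ⁻¹' {G}) ≤ μ := by
    rcases (p ⁻¹' {G}).subsingleton_or_nontrivial with hss | ⟨x, hx, y, hy, hxy⟩
    · exact (mk_le_one_iff_set_subsingleton.2 hss).trans (one_le_aleph0.trans hμ)
    have hg : ∀ z ∈ p ⁻¹' {G}, (z : A) ⊓ s = G.1.sup Subtype.val := by
      rintro z rfl
      exact htrace z (hTS z.2)
    have hgxy : (x : A) ⊓ y = G.1.sup Subtype.val := by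
      have h1 : (x : A) ⊓ y ⊓ sᶜ = ⊥ := by
        rw [inf_inf_distrib_right]
        exact (hT x.2 y.2 (Subtype.coe_injective.ne hxy)).eq_bot
      have h2 : (x : A) ⊓ y ⊓ s = G.1.sup Subtype.val := by
        rw [inf_inf_distrib_right, hg x hx, hg y hy, inf_idem]
      rw [← sup_inf_inf_compl (x := (x : A) ⊓ y) (y := s), h1, h2, sup_bot_eq]
    have hgS : G.1.sup Subtype.val ∈ S := hgxy ▸ hS.inf_mem _ (hTS x.2) _ (hTS y.2)
    have hzg : ∀ z ∈ p ⁻¹' {G}, (z : A) ⊓ (G.1.sup Subtype.val)ᶜ = (z : A) ⊓ sᶜ := by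
      intro z hz
      rw [← hg z hz, compl_inf, inf_sup_left, inf_compl_self, bot_sup_eq]
    rw [← mk_image_eq (Subtype.val_injective) (s := p ⁻¹' {G})]
    refine (mk_le_cellularityOn_of_family (S := S)
      (f := fun b => b ⊓ (G.1.sup Subtype.val)ᶜ) ?_ ?_ ?_).trans hcell
    · rintro _ ⟨z, -, rfl⟩
      exact hS.inf_mem _ (hTS z.2) _ (hS.compl_mem _ hgS)
    · rintro _ ⟨z, hz, rfl⟩
      rw [hzg z hz]
      exact h0 z z.2
    · rintro _ ⟨z, hz, rfl⟩ _ ⟨w, hw, rfl⟩ hne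
      simp only [Function.onFun]
      rw [hzg z hz, hzg w hw]
      exact hT z.2 w.2 hne
  calc #T ≤ #F.powerset * μ := mk_le_mk_mul_of_mk_preimage_le p hfib
    _ ≤ μ * μ := by gcongr; exact (lt_aleph0_of_finite _).le.trans hμ
    _ = μ := mul_eq_self hμ

theorem exists_subalgebra_of_adjoin {E : Set A} {μ ν : Cardinal.{u}} (hμ : ℵ₀ ≤ μ) (hμν : μ ≤ ν)
    (hS : IsBoolSubalgebra S) (hSν : #S = ν) (hE : #E = μ) (hE0 : ∀ e ∈ E, e ≠ ⊥)
    (hEd : E.PairwiseDisjoint id)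
    (h : ∀ i : E ⊕ Finset E, ∀ T ⊆ S,
      (∀ b ∈ T, b ⊓ Sum.elim Subtype.val (fun F => (F.sup Subtype.val)ᶜ) i ≠ ⊥) →
      T.PairwiseDisjoint (fun b => b ⊓ Sum.elim Subtype.val (fun F => (F.sup Subtype.val)ᶜ) i) →
      #T ≤ μ) :
    ∃ S' : Set A, IsBoolSubalgebra S' ∧ #S' = ν ∧ cellularityOn S' = μ :=
  ⟨IsBoolSubalgebra.adjoin S E, hS.adjoin_isBoolSubalgebra E,
    le_antisymm (IsBoolSubalgebra.mk_adjoin_le (hμ.trans hμν) hSν.le (hE ▸ hμν))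
      (hSν ▸ mk_le_mk_of_subset (IsBoolSubalgebra.subset_adjoin S E)),
    cellularityOn_adjoin hμ hS hE hE0 hEd h⟩

/-- The elements of a subalgebra that contain or are disjoint from each member of `E` form a
subalgebra. -/
theorem IsBoolSubalgebra.sep_le_or_disjoint (hS : IsBoolSubalgebra S) (E : Set A) :
    IsBoolSubalgebra {b ∈ S | ∀ e ∈ E, e ≤ b ∨ Disjoint b e} where
  bot_mem := ⟨hS.bot_mem, fun _ _ => Or.inr disjoint_bot_left⟩
  top_mem := ⟨hS.top_mem, fun _ _ => Or.inl le_top⟩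
  inf_mem := fun x hx y hy => ⟨hS.inf_mem _ hx.1 _ hy.1, fun e he => by
    rcases hx.2 e he with h | h
    · rcases hy.2 e he with h' | h'
      · exact Or.inl (le_inf h h')
      · exact Or.inr (h'.mono_left inf_le_right)
    · exact Or.inr (h.mono_left inf_le_left)⟩
  sup_mem := fun x hx y hy => ⟨hS.sup_mem _ hx.1 _ hy.1, fun e he => by
    rcases hx.2 e he with h | h
    · exact Or.inl (h.trans le_sup_left)
    · rcases hy.2 e he with h' | h'
      · exact Or.inl (h'.trans le_sup_right)
      · exact Or.inr (h.sup_left h')⟩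
  compl_mem := fun x hx => ⟨hS.compl_mem _ hx.1, fun e he => by
    rcases hx.2 e he with h | h
    · exact Or.inr (disjoint_compl_left.mono_right h)
    · exact Or.inl h.le_compl_left⟩

end Cellularity

theorem stmt_8 (κ : Cardinal.{u}) (hκ : ℵ₀ ≤ κ)
    (A : Type u) [BooleanAlgebra A] [Infinite A]
    (hcell : Order.succ (Order.succ κ) ≤ cellularityBA A)
    (hsub : ∃ S : Set A, IsBoolSubalgebra S ∧ #S = Order.succ (Order.succ κ) ∧
      cellularityOn S = κ) :
    ∃ S : Set A, IsBoolSubalgebra S ∧ #S = Order.succ (Order.succ κ) ∧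
      cellularityOn S = Order.succ κ := by
  obtain ⟨S, hS, hcard, hSκ⟩ := hsub
  have hμ : ℵ₀ ≤ Order.succ κ := hκ.trans (Order.le_succ κ)
  by_cases hd : ∀ d : A, ∀ T ⊆ S, (∀ b ∈ T, b ⊓ d ≠ ⊥) →
      T.PairwiseDisjoint (fun b => b ⊓ d) → #T ≤ Order.succ κ
  · obtain ⟨E, hE0, hEd, hE⟩ :=
      exists_disjoint_of_lt_cellularityBA ((Order.lt_succ (Order.succ κ)).trans_le hcell)
    exact exists_subalgebra_of_adjoin hμ (Order.le_succ _) hS hcard hE hE0 hEd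
      fun i => hd _
  · push Not at hd
    obtain ⟨d, T, hTS, hT0, hTd, hT⟩ := hd
    obtain ⟨T', hT', hcardT⟩ := le_mk_iff_exists_subset.1 hT.le
    set E : Set A := (fun b => b ⊓ d) '' T' with hEdef
    have hinj : Set.InjOn (fun b => b ⊓ d) T' := fun x hx y hy hxy => by
      by_contra hne
      have h := hTd (hT' hx) (hT' hy) hne
      simp only [Function.onFun] at h hxy
      rw [← hxy, disjoint_self] at h
      exact hT0 x (hT' hx) h
    have hE : #E = Order.succ κ := by rw [hEdef, mk_image_eq_of_injOn _ _ hinj, hcardT]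
    have hE0 : ∀ e ∈ E, e ≠ ⊥ := by
      rintro _ ⟨b, hb, rfl⟩
      exact hT0 b (hT' hb)
    have hEd : E.PairwiseDisjoint id := by
      rintro _ ⟨x, hx, rfl⟩ _ ⟨y, hy, rfl⟩ hne
      exact hTd (hT' hx) (hT' hy) fun h => hne (by rw [h])
    set R : Set A := {b ∈ S | ∀ e ∈ E, e ≤ b ∨ Disjoint b e}
    have hR : IsBoolSubalgebra R := hS.sep_le_or_disjoint E
    have hRS : R ⊆ S := fun b hb => hb.1
    have hTR : T ⊆ R := by
      refine fun b hb => ⟨hTS hb, ?_⟩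
      rintro _ ⟨x, hx, rfl⟩
      by_cases h : b = x
      · exact Or.inl (h ▸ inf_le_left)
      · refine Or.inr ?_
        have := hTd hb (hT' hx) h
        simp only [Function.onFun] at this
        rw [disjoint_iff] at this ⊢
        rwa [← inf_inf_distrib_right, inf_assoc] at this
    have hRcard : #R = Order.succ (Order.succ κ) :=
      le_antisymm (hcard ▸ mk_le_mk_of_subset hRS)
        ((Order.succ_le_of_lt hT).trans (mk_le_mk_of_subset hTR))
    have hRcell : cellularityOn R ≤ Order.succ κ := by
      refine csSup_le' ?_
      rintro _ ⟨U, hU, hU0, hUd, rfl⟩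
      exact (mk_le_cellularityOn (hU.trans hRS) hU0 hUd).trans (hSκ.le.trans (Order.le_succ κ))
    refine exists_subalgebra_of_adjoin hμ (Order.le_succ _) hR hRcard hE hE0 hEd ?_
    rintro (e | F) U hU hU0 hUd
    · refine (mk_le_one_iff_set_subsingleton.2 fun x hx y hy => ?_).trans
        (one_le_aleph0.trans hμ)
      by_contra hne
      have hle : ∀ z ∈ U, (e : A) ≤ z := fun z hz =>
        ((hU hz).2 e e.2).resolve_right fun h => hU0 z hz h.eq_bot
      have h := hUd hx hy hne
      simp only [Function.onFun, Sum.elim_inl] at h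
      rw [inf_eq_right.2 (hle x hx), inf_eq_right.2 (hle y hy), disjoint_self] at h
      exact hE0 e e.2 h
    · exact mk_le_of_pairwiseDisjoint_inf_compl_sup hμ hR hRcell (fun b hb => hb.2) F hU hU0 hUd
end

section
/- Assume GCH. Then for every infinite cardinal μ there is a complete Boolean algebra A with |A| = 2^μ such that no infinite cardinal is a free caliber of A; that is, for every infinite cardinal λ ≤ 2^μ there is a subset X ⊆ A with |X| = λ such that every independent subset of X has cardinality less than λ. -/
universe u

open Cardinal

/-- A subset `X` of a Boolean algebra is independent if for all disjoint finite subsets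
`F`, `G` of `X`, the element `⨅_{x ∈ F} x ⊓ ⨅_{y ∈ G} yᶜ` is nonzero. -/
def IndepSet {A : Type u} [BooleanAlgebra A] (X : Set A) : Prop :=
  ∀ F G : Finset A, ↑F ⊆ X → ↑G ⊆ X → Disjoint F G →
    F.inf id ⊓ G.inf (fun y => yᶜ) ≠ ⊥

/-- Two comparable elements of an independent set are equal. -/
theorem IndepSet.eq_of_le {A : Type u} [BooleanAlgebra A] {Y : Set A} (hY : IndepSet Y)
    {a b : A} (ha : a ∈ Y) (hb : b ∈ Y) (hab : a ≤ b) : a = b := by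
  by_contra hne
  refine hY {a} {b} (by simpa using ha) (by simpa using hb) (by simpa using hne) ?_
  simpa [← sdiff_eq] using hab

theorem IndepSet.subsingleton_of_isChain {A : Type u} [BooleanAlgebra A] {Y : Set A}
    (hY : IndepSet Y) (hc : IsChain (· ≤ ·) Y) : Y.Subsingleton := by
  intro a ha b hb
  rcases hc.total ha hb with h | h
  · exact hY.eq_of_le ha hb h
  · exact (hY.eq_of_le hb ha h).symm

/-- The binary sequence with support `s ∪ {i}`, where `s` consists of indices below `i`. -/
noncomputable def binarySeq {J : Type u} [LinearOrder J] (p : Σ i : J, Set (Set.Iio i)) :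
    Lex (J → Prop) :=
  toLex fun j => j = p.1 ∨ ∃ h : j < p.1, (⟨j, h⟩ : Set.Iio p.1) ∈ p.2

theorem exists_lt_binarySeq_le {J : Type u} [LinearOrder J] [WellFoundedLT J]
    {x y : Lex (J → Prop)} (h : x < y) : ∃ p, x < binarySeq p ∧ binarySeq p ≤ y := by
  obtain ⟨i, hi, hlt⟩ := h
  obtain ⟨hxi, hyi⟩ : ¬ x i ∧ y i := by
    have := hlt.not_ge
    simpa [and_comm] using this
  refine ⟨⟨i, {j | y j}⟩, ⟨i, fun j hj => ?_, ?_⟩, ?_⟩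
  · have hj' : j < i := hj
    have hij : x j = y j := hi j hj
    simp [binarySeq, hj', hj'.ne, hij]
  · refine lt_of_le_not_ge (fun h => absurd h hxi) fun h => hxi (h ?_)
    exact Or.inl rfl
  · refine Pi.toLex_monotone (a := ofLex (binarySeq _)) (b := ofLex y) fun j hj => ?_
    rcases hj with rfl | ⟨_, h⟩
    · exact hyi
    · exact h

/-- The power set of an infinite type `α` contains a chain of cardinality greater than `#α`. -/
theorem exists_isChain_set (α : Type u) [Infinite α] :
    ∃ C : Set (Set α), IsChain (· ≤ ·) C ∧ #α < #C := by
  obtain ⟨ν, hν, hmin⟩ := WellFounded.has_min (r := ((· < ·) : Cardinal.{u} → Cardinal.{u} → Prop))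
    Cardinal.lt_wf {c | #α < 2 ^ c} ⟨#α, cantor _⟩
  have hle : ν ≤ #α := not_lt.1 (hmin _ (cantor _))
  let J := ν.ord.ToType
  have hsigma : #(Σ i : J, Set (Set.Iio i)) ≤ #α := by
    rw [mk_sigma]
    refine (sum_le_mk_mul_iSup _).trans ?_
    refine (mul_le_mul' (b := #α) (d := #α) ?_ (ciSup_le' fun i => ?_)).trans
      (mul_eq_self (aleph0_le_mk α)).le
    · simpa [J] using hle
    · rw [mk_set]
      exact not_lt.1 fun h => hmin _ h (by simpa [J] using mk_Iio_lt i (by simp [J]))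
  obtain ⟨e⟩ := hsigma
  let cut : Lex (J → Prop) → Set α := fun x => e '' {p | binarySeq p ≤ x}
  have hmono : Monotone cut := fun x y h => Set.image_mono fun p hp => le_trans hp h
  have hstrict : StrictMono cut := fun x y h => by
    refine (hmono h.le).lt_of_ne fun heq => ?_
    obtain ⟨p, hxp, hpy⟩ := exists_lt_binarySeq_le h
    have hset := e.injective.image_injective heq
    exact hxp.not_ge (hset.symm.subset hpy)
  refine ⟨Set.range cut, hmono.isChain_range, ?_⟩
  rw [mk_range_eq _ hstrict.injective]
  have hcard : #(Lex (J → Prop)) = 2 ^ ν := by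
    change #(J → Prop) = _
    simp [J]
  rwa [hcard]

theorem stmt_12 (gch : ∀ c : Cardinal.{u}, ℵ₀ ≤ c → 2 ^ c = Order.succ c)
    (μ : Cardinal.{u}) (hμ : ℵ₀ ≤ μ) :
    ∃ (A : Type u) (_ : CompleteBooleanAlgebra A), #A = 2 ^ μ ∧
      ∀ l : Cardinal.{u}, ℵ₀ ≤ l → l ≤ 2 ^ μ →
        ∃ X : Set A, #X = l ∧ ∀ Y : Set A, Y ⊆ X → IndepSet Y → #Y < l := by
  have : Infinite μ.out := infinite_iff.2 (by simpa using hμ)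
  refine ⟨Set μ.out, inferInstance, by simp, fun l hl hlμ => ?_⟩
  obtain ⟨C, hC, hcard⟩ := exists_isChain_set μ.out
  rw [mk_out] at hcard
  have hlC : l ≤ #C := hlμ.trans ((gch μ hμ).le.trans (Order.succ_le_of_lt hcard))
  obtain ⟨X, hXC, hX⟩ := le_mk_iff_exists_subset.1 hlC
  refine ⟨X, hX, fun Y hYX hY => ?_⟩
  have hsub := hY.subsingleton_of_isChain (hC.mono (hYX.trans hXC))
  exact (mk_le_one_iff_set_subsingleton.2 hsub).trans_lt (one_lt_aleph0.trans_le hl)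
end
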